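/- arXiv:1412.2993 — 5 statements merged into one kernel-verified Lean document; each statement's English description precedes it below -/
import Mathlib

section
/- Every finite Bayesian game has a Nash equilibrium in behavioral strategies: there exists a profile σ = (σ_1,…,σ_m) of behavioral strategies such that for every player i and every behavioral strategy σ′_i : T_i → Δ(A_i), U_i(σ) ≥ U_i(σ′_i, σ_{−i}). -/
open Finset

/-- A probability distribution on a finite set: nonnegative weights summing to 1. -/
def IsDist {S : Type*} [Fintype S] (μ : S → ℝ) : Prop :=
  (∀ s, 0 ≤ μ s) ∧ ∑ s, μ s = 1

/-- A behavioral strategy for player `i`: a distribution on actions for each type. -/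
def IsBehavioral {T A : Type*} [Fintype A] (σ : T → A → ℝ) : Prop :=
  ∀ t, IsDist (σ t)

/-- The ex ante expected utility of player `i` in a finite Bayesian game under
the behavioral-strategy profile `σ`. -/
noncomputable def bayesExpUtil {m : ℕ} {T A : Fin m → Type*}
    [∀ i, Fintype (T i)] [∀ i, Fintype (A i)]
    (p : (∀ i, T i) → ℝ)
    (u : Fin m → (∀ i, T i) → (∀ i, A i) → ℝ)
    (σ : ∀ i, T i → A i → ℝ) (i : Fin m) : ℝ :=
  ∑ t : ∀ j, T j, p t * ∑ a : ∀ j, A j, (∏ j, σ j (t j) (a j)) * u i t a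

section Scarf

variable {S I : Type*}

/-- A set `s` is dominated with respect to the indices `C` when no point lies strictly above
the `i`-minimum of `s` for all `i ∈ C` simultaneously. -/
def IsDominated (r : I → S → ℕ) (s : Finset S) (C : Finset I) : Prop :=
  ∀ y, ∃ i ∈ C, ∀ x ∈ s, r i y ≤ r i x

/-- The pair `R` arises from `d` by adding a point to the first component, or by removing
an index from the second. -/
def IsDoorOf [DecidableEq S] [DecidableEq I] (d R : Finset S × Finset I) : Prop :=
  (∃ x ∉ d.1, R = (insert x d.1, d.2)) ∨ ∃ k ∈ d.2, R = (d.1, d.2.erase k)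

/-- The points lying strictly above the `k`-minimum of `s` for all `k ∈ D` other than `i`. -/
def aboveExcept (r : I → S → ℕ) (s : Finset S) (D : Finset I) (i : I) : Set S :=
  {y | ∀ k ∈ D, k ≠ i → ∃ x ∈ s, r k x < r k y}

/-- `R` is the room obtained from the door `(s, D)` by relaxing the index `i`. -/
def IsPivot [DecidableEq S] [DecidableEq I] (r : I → S → ℕ) (s : Finset S) (D : Finset I)
    (i : I) (R : Finset S × Finset I) : Prop :=
  (aboveExcept r s D i = ∅ ∧ R = (s, D.erase i)) ∨
    ∃ y ∈ aboveExcept r s D i, (∀ z ∈ aboveExcept r s D i, r i z ≤ r i y) ∧ R = (insert y s, D)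

lemma IsDominated.mono {r : I → S → ℕ} {s s' : Finset S} {C C' : Finset I}
    (h : IsDominated r s C) (hs : s' ⊆ s) (hC : C ⊆ C') : IsDominated r s' C' := fun y ↦
  let ⟨i, hi, hy⟩ := h y
  ⟨i, hC hi, fun x hx ↦ hy x (hs hx)⟩

lemma IsDominated.index_unique {r : I → S → ℕ} (hr : ∀ i, Function.Injective (r i))
    {s : Finset S} {C : Finset I} (h : IsDominated r s C) (hc : #s = #C)
    {x : S} (hx : x ∈ s) {i j : I} (hi : i ∈ C) (hj : j ∈ C)
    (hxi : ∀ y ∈ s, r i x ≤ r i y) (hxj : ∀ y ∈ s, r j x ≤ r j y) : i = j := by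
  choose g hgC hg using h
  have hinj : Set.InjOn g s := fun a ha b hb hab ↦
    hr (g a) (le_antisymm (hg a b hb) (hab ▸ hg b a ha))
  have hsurj : Set.SurjOn g s C :=
    Finset.surjOn_of_injOn_of_card_le g (fun a _ ↦ hgC a) hinj hc.ge
  have key : ∀ k ∈ C, (∀ y ∈ s, r k x ≤ r k y) → g x = k := by
    intro k hk hxk
    obtain ⟨a, ha, rfl⟩ := hsurj hk
    rw [hr (g a) (le_antisymm (hxk a ha) (hg a x hx))]
  rw [← key i hi hxi, ← key j hj hxj]

lemma existsUnique_isPivot [Finite S] [DecidableEq S] [DecidableEq I] {r : I → S → ℕ}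
    (hr : ∀ i, Function.Injective (r i)) (s : Finset S) (D : Finset I) (i : I) :
    ∃! R, IsPivot r s D i R := by
  rcases (aboveExcept r s D i).eq_empty_or_nonempty with h | h
  · exact ⟨(s, D.erase i), Or.inl ⟨h, rfl⟩, by
      rintro R (⟨-, rfl⟩ | ⟨y, hy, -⟩)
      · rfl
      · simp [h] at hy⟩
  · obtain ⟨y, hy, hmax⟩ := Set.exists_max_image _ (r i) (Set.toFinite _) h
    refine ⟨(insert y s, D), Or.inr ⟨y, hy, hmax, rfl⟩, ?_⟩
    rintro R (⟨h', -⟩ | ⟨z, hz, hzmax, rfl⟩)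
    · exact absurd h' h.ne_empty
    · rw [hr i (le_antisymm (hmax z hz) (hzmax y hy))]

lemma le_of_mem_aboveExcept {r : I → S → ℕ} {s : Finset S} {D : Finset I}
    (h : IsDominated r s D) {i : I} {y : S} (hy : y ∈ aboveExcept r s D i) :
    ∀ x ∈ s, r i y ≤ r i x := by
  obtain ⟨k, hk, hle⟩ := h y
  by_cases hki : k = i
  · exact hki ▸ hle
  · obtain ⟨x, hx, hlt⟩ := hy k hk hki
    exact absurd (hle x hx) hlt.not_ge

section Door

variable [DecidableEq S] [DecidableEq I] {r : I → S → ℕ} {s : Finset S} {D : Finset I}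

lemma IsPivot.isRoom (h : IsDominated r s D) (hc : #D = #s + 1) {i : I} (hi : i ∈ D)
    (hmin : ∀ x ∈ s, ∃ k ∈ D, k ≠ i ∧ ∀ y ∈ s, r k x ≤ r k y) {R : Finset S × Finset I}
    (hR : IsPivot r s D i R) :
    IsDominated r R.1 R.2 ∧ #R.1 = #R.2 ∧ IsDoorOf (s, D) R := by
  rcases hR with ⟨he, rfl⟩ | ⟨y, hy, hmax, rfl⟩
  · refine ⟨fun y ↦ ?_, by simp [card_erase_of_mem hi, hc], Or.inr ⟨i, hi, rfl⟩⟩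
    have hy : y ∉ aboveExcept r s D i := by simp [he]
    simp only [aboveExcept, Set.mem_ofPred_eq] at hy
    push Not at hy
    obtain ⟨k, hk, hki, hle⟩ := hy
    exact ⟨k, mem_erase.2 ⟨hki, hk⟩, hle⟩
  · have hys : y ∉ s := by
      intro hys
      obtain ⟨k, hk, hki, hle⟩ := hmin y hys
      obtain ⟨x, hx, hlt⟩ := hy k hk hki
      exact absurd (hle x hx) hlt.not_ge
    refine ⟨fun z ↦ ?_, by simp [card_insert_of_notMem hys, hc], Or.inl ⟨y, hys, rfl⟩⟩
    by_contra! hz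
    have hzM : z ∈ aboveExcept r s D i := by
      intro k hk hki
      obtain ⟨x, hx, hlt⟩ := hz k hk
      rcases mem_insert.1 hx with rfl | hx
      · obtain ⟨w, hw, hwlt⟩ := hy k hk hki
        exact ⟨w, hw, hwlt.trans hlt⟩
      · exact ⟨x, hx, hlt⟩
    obtain ⟨x, hx, hlt⟩ := hz i hi
    rcases mem_insert.1 hx with rfl | hx
    · exact (hmax z hzM).not_gt hlt
    · exact (le_of_mem_aboveExcept h hzM x hx).not_gt hlt

lemma isPivot_of_insert (hr : ∀ i, Function.Injective (r i)) {y : S}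
    (h : IsDominated r (insert y s) D) (hc : #(insert y s) = #D) {i : I} (hi : i ∈ D)
    (hle : ∀ x ∈ s, r i y ≤ r i x) : IsPivot r s D i (insert y s, D) := by
  have hle' : ∀ x ∈ insert y s, r i y ≤ r i x := by simpa using hle
  refine Or.inr ⟨y, fun k hk hki ↦ ?_, fun z hz ↦ ?_, rfl⟩
  · by_contra! hk'
    refine hki (h.index_unique hr hc (mem_insert_self y s) hk hi ?_ hle')
    simpa using hk'
  · obtain ⟨k, hk, hzk⟩ := h z
    by_cases hki : k = i
    · subst hki
      exact hzk y (mem_insert_self y s)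
    · obtain ⟨x, hx, hlt⟩ := hz k hk hki
      exact absurd (hzk x (mem_insert_of_mem hx)) hlt.not_ge

/-- A door with nonempty point set belongs to exactly two rooms. -/
lemma exists_two_rooms [Finite S] (hr : ∀ i, Function.Injective (r i))
    (h : IsDominated r s D) (hc : #D = #s + 1) (hs : s.Nonempty) :
    ∃ R₁ R₂, R₁ ≠ R₂ ∧ ∀ R : Finset S × Finset I,
      (IsDominated r R.1 R.2 ∧ #R.1 = #R.2 ∧ IsDoorOf (s, D) R) ↔ R = R₁ ∨ R = R₂ := by
  choose g hg hgle using fun i ↦ s.exists_min_image (r i) hs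
  obtain ⟨i, hi, j, hj, hij, hgij⟩ :=
    exists_ne_map_eq_of_card_lt_of_maps_to (by omega : #s < #D) (fun i _ ↦ hg i)
  have hmin : ∀ l, l = i ∨ l = j → ∀ x ∈ s, ∃ k ∈ D, k ≠ l ∧ ∀ y ∈ s, r k x ≤ r k y := by
    intro l hl x hx
    obtain ⟨k, hk, hle⟩ := h x
    by_cases hkl : k = l
    · have hxg : x = g k := hr k (le_antisymm (hle _ (hg k)) (hgle k x hx))
      rcases hl with rfl | rfl
      · exact ⟨j, hj, hij.symm, by rw [hxg, hkl, hgij]; exact hgle j⟩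
      · exact ⟨i, hi, hij, by rw [hxg, hkl, ← hgij]; exact hgle i⟩
    · exact ⟨k, hk, hkl, hle⟩
  obtain ⟨R₁, hR₁, hu₁⟩ := existsUnique_isPivot hr s D i
  obtain ⟨R₂, hR₂, hu₂⟩ := existsUnique_isPivot hr s D j
  have hroom₁ := hR₁.isRoom h hc hi (hmin i (.inl rfl))
  have hroom₂ := hR₂.isRoom h hc hj (hmin j (.inr rfl))
  refine ⟨R₁, R₂, ?_, fun R ↦ ⟨?_, ?_⟩⟩
  · rintro rfl
    rcases hR₁ with ⟨-, h₁⟩ | ⟨y, hy, -, h₁⟩ <;> rcases hR₂ with ⟨-, h₂⟩ | ⟨z, hz, -, h₂⟩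
    · rw [h₁, Prod.mk.injEq] at h₂
      have : i ∈ D.erase j := mem_erase.2 ⟨hij, hi⟩
      rw [← h₂.2] at this
      simp at this
    · rw [h₁, Prod.mk.injEq] at h₂
      exact notMem_erase i D ((Finset.ext_iff.1 h₂.2 i).2 hi)
    · rw [h₁, Prod.mk.injEq] at h₂
      exact notMem_erase j D ((Finset.ext_iff.1 h₂.2 j).1 hj)
    · rw [h₁, Prod.mk.injEq] at h₂
      rw [h₁] at hroom₁
      refine hij (hroom₁.1.index_unique hr hroom₁.2.1 (mem_insert_self y s) hi hj ?_ ?_)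
      · simpa using le_of_mem_aboveExcept h hy
      · have hyz : y = z ∨ y ∈ s := mem_insert.1 (h₂.1 ▸ mem_insert_self y s)
        have hys : y ∉ s := by
          intro hys
          obtain ⟨k, hk, hki, hle⟩ := hmin i (.inl rfl) y hys
          obtain ⟨x, hx, hlt⟩ := hy k hk hki
          exact absurd (hle x hx) hlt.not_ge
        obtain rfl := hyz.resolve_right hys
        simpa using le_of_mem_aboveExcept h hz
  · rintro ⟨hdom, hcard, ⟨y, hys, rfl⟩ | ⟨k, hk, rfl⟩⟩
    · have hex : (∀ x ∈ s, r i y ≤ r i x) ∨ ∀ x ∈ s, r j y ≤ r j x := by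
        by_contra! hcon
        obtain ⟨⟨a, ha, hai⟩, b, hb, hbj⟩ := hcon
        refine hij (hdom.index_unique hr hcard (mem_insert_of_mem (hg i)) hi hj ?_ ?_)
        · simpa using ⟨(hgle i a ha).trans hai.le, hgle i⟩
        · rw [hgij]
          simpa using ⟨(hgle j b hb).trans hbj.le, hgle j⟩
      rcases hex with hle | hle
      · exact .inl (hu₁ _ (isPivot_of_insert hr hdom hcard hi hle))
      · exact .inr (hu₂ _ (isPivot_of_insert hr hdom hcard hj hle))
    · have hkij : k = i ∨ k = j := by
        by_contra! hcon
        refine hij (hdom.index_unique hr hcard (hg i) (mem_erase.2 ⟨hcon.1.symm, hi⟩)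
          (mem_erase.2 ⟨hcon.2.symm, hj⟩) (hgle i) ?_)
        rw [hgij]
        exact hgle j
      have hpiv : IsPivot r s D k (s, D.erase k) := by
        refine Or.inl ⟨Set.eq_empty_of_forall_notMem fun y hy ↦ ?_, rfl⟩
        obtain ⟨l, hl, hle⟩ := hdom y
        obtain ⟨x, hx, hlt⟩ := hy l (mem_of_mem_erase hl) (ne_of_mem_erase hl)
        exact absurd (hle x hx) hlt.not_ge
      rcases hkij with rfl | rfl
      · exact .inl (hu₁ _ hpiv)
      · exact .inr (hu₂ _ hpiv)
  · rintro (rfl | rfl)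
    · exact hroom₁
    · exact hroom₂

end Door

/-- The empty door with a single index belongs to exactly one room. -/
lemma exists_unique_room_of_empty [Finite S] [Nonempty S] [DecidableEq S] [DecidableEq I]
    {r : I → S → ℕ} (hr : ∀ i, Function.Injective (r i)) (i : I) :
    ∃ R₁, ∀ R : Finset S × Finset I,
      (IsDominated r R.1 R.2 ∧ #R.1 = #R.2 ∧ IsDoorOf (∅, {i}) R) ↔ R = R₁ := by
  obtain ⟨x, hx⟩ := Finite.exists_max (r i)
  refine ⟨({x}, {i}), fun R ↦ ⟨?_, ?_⟩⟩
  · rintro ⟨hdom, hcard, ⟨y, -, rfl⟩ | ⟨k, hk, rfl⟩⟩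
    · obtain ⟨k, hk, hle⟩ := hdom x
      obtain rfl := mem_singleton.1 hk
      have := hr k (le_antisymm (hle y (by simp)) (hx y))
      simp [this]
    · obtain rfl := mem_singleton.1 hk
      obtain ⟨l, hl, -⟩ := hdom x
      simp at hl
  · rintro rfl
    exact ⟨fun y ↦ ⟨i, by simp, by simpa using hx y⟩, by simp, Or.inl ⟨x, by simp, rfl⟩⟩

/-- A door is almost colored if its colors are exactly its indices other than `i₀`. -/
def IsAlmostColored [DecidableEq I] (c : S → I) (i₀ : I) (d : Finset S × Finset I) : Prop :=
  #d.2 = #d.1 + 1 ∧ i₀ ∈ d.2 ∧ d.1.image c = d.2.erase i₀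

/-- A room that is not fully colored has either no or two almost colored doors. -/
lemma almostColored_doors_of_room [DecidableEq S] [DecidableEq I] (c : S → I) (i₀ : I)
    {s : Finset S} {C : Finset I} (hc : #s = #C) (hne : s.image c ≠ C) :
    (∀ d, ¬ (IsAlmostColored c i₀ d ∧ IsDoorOf d (s, C))) ∨
    ∃ d₁ d₂, d₁ ≠ d₂ ∧ ∀ d, (IsAlmostColored c i₀ d ∧ IsDoorOf d (s, C)) ↔ d = d₁ ∨ d = d₂ := by
  have hdoor : ∀ d, (IsAlmostColored c i₀ d ∧ IsDoorOf d (s, C)) ↔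
      (∃ x ∈ s, i₀ ∈ C ∧ (s.erase x).image c = C.erase i₀ ∧ d = (s.erase x, C)) ∨
      ∃ k ∉ C, i₀ ∈ insert k C ∧ s.image c = (insert k C).erase i₀ ∧ d = (s, insert k C) := by
    rintro ⟨t, D⟩
    constructor
    · rintro ⟨⟨-, h₂, h₃⟩, ⟨x, hx, h⟩ | ⟨k, hk, h⟩⟩
      · obtain ⟨rfl, rfl⟩ := Prod.mk.inj h
        refine .inl ⟨x, mem_insert_self _ _, h₂, ?_⟩
        rw [erase_insert hx]
        exact ⟨h₃, rfl⟩
      · obtain ⟨rfl, rfl⟩ := Prod.mk.inj h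
        refine .inr ⟨k, notMem_erase _ _, ?_⟩
        rw [insert_erase hk]
        exact ⟨h₂, h₃, rfl⟩
    · rintro (⟨x, hx, hi, him, h⟩ | ⟨k, hk, hi, him, h⟩)
      · obtain ⟨rfl, rfl⟩ := Prod.mk.inj h
        refine ⟨⟨?_, hi, him⟩, .inl ⟨x, notMem_erase _ _, by simp [insert_erase hx]⟩⟩
        rw [card_erase_add_one hx, hc]
      · obtain ⟨rfl, rfl⟩ := Prod.mk.inj h
        refine ⟨⟨?_, hi, him⟩, .inr ⟨k, mem_insert_self _ _, by simp [erase_insert hk]⟩⟩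
        rw [card_insert_of_notMem hk, hc]
  simp only [hdoor]
  by_cases hi₀ : i₀ ∈ C
  swap
  · left
    rintro d (⟨x, -, h, -⟩ | ⟨k, hk, h, him, -⟩)
    · exact hi₀ h
    · obtain rfl := (mem_insert.1 h).resolve_right hi₀
      exact hne (by rw [him, erase_insert hk])
  have hpos : 0 < #C := card_pos.2 ⟨i₀, hi₀⟩
  by_cases ha : ∃ k ∉ C, s.image c = (insert k C).erase i₀
  · obtain ⟨k, hk, him⟩ := ha
    have hki : k ≠ i₀ := fun h ↦ hk (h ▸ hi₀)
    have hinj : Set.InjOn c s := by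
      rw [← card_image_iff, him, card_erase_of_mem (mem_insert_of_mem hi₀),
        card_insert_of_notMem hk, hc]
      simp
    obtain ⟨x, hx, hxk⟩ := mem_image.1 (him ▸ mem_erase.2 ⟨hki, mem_insert_self k C⟩)
    right
    refine ⟨(s, insert k C), (s.erase x, C), ?_, fun d ↦ ⟨?_, ?_⟩⟩
    · intro h
      exact hk ((Prod.mk.inj h).2 ▸ mem_insert_self k C)
    · rintro (⟨y, hy, -, hyim, rfl⟩ | ⟨l, hl, -, hlim, rfl⟩)
      · have hxy : x = y := by
          by_contra hxy
          have : c x ∈ C.erase i₀ := hyim ▸ mem_image_of_mem c (mem_erase.2 ⟨hxy, hx⟩)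
          exact hk (hxk ▸ mem_of_mem_erase this)
        simp [hxy]
      · have : k ∈ (insert l C).erase i₀ := by
          rw [← hlim, him]
          exact mem_erase.2 ⟨hki, mem_insert_self k C⟩
        obtain rfl := (mem_insert.1 (mem_of_mem_erase this)).resolve_right hk
        exact .inl rfl
    · rintro (rfl | rfl)
      · exact .inr ⟨k, hk, mem_insert_of_mem hi₀, him, rfl⟩
      · refine .inl ⟨x, hx, hi₀, ?_, rfl⟩
        ext l
        have hl := Finset.ext_iff.1 him l
        simp only [mem_image, mem_erase, mem_insert] at hl ⊢
        constructor
        · rintro ⟨y, ⟨hyx, hy⟩, rfl⟩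
          have h1 := hl.1 ⟨y, hy, rfl⟩
          refine ⟨h1.1, h1.2.resolve_left fun h ↦ hyx (hinj hy hx (h.trans hxk.symm))⟩
        · rintro ⟨hli, hlC⟩
          obtain ⟨y, hy, rfl⟩ := hl.2 ⟨hli, .inr hlC⟩
          refine ⟨y, ⟨?_, hy⟩, rfl⟩
          rintro rfl
          exact hk (hxk ▸ hlC)
  by_cases hb : s.image c = C.erase i₀
  · have hlt : #(s.image c) < #s := by
      rw [hb, card_erase_of_mem hi₀, hc]
      omega
    obtain ⟨x, hx, y, hy, hxy, hcxy⟩ :=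
      exists_ne_map_eq_of_card_lt_of_maps_to hlt (fun a ha ↦ mem_image_of_mem c ha)
    have herase : ∀ a ∈ s, ∀ b ∈ s, a ≠ b → c a = c b → (s.erase a).image c = C.erase i₀ := by
      intro a ha b hb' hab hcab
      rw [← hb]
      refine (image_subset_image (erase_subset _ _)).antisymm fun l hl ↦ ?_
      obtain ⟨z, hz, rfl⟩ := mem_image.1 hl
      by_cases hza : z = a
      · exact mem_image.2 ⟨b, mem_erase.2 ⟨hab.symm, hb'⟩, by rw [hza, hcab]⟩
      · exact mem_image_of_mem c (mem_erase.2 ⟨hza, hz⟩)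
    right
    refine ⟨(s.erase x, C), (s.erase y, C), ?_, fun d ↦ ⟨?_, ?_⟩⟩
    · intro h
      have : y ∈ s.erase x := mem_erase.2 ⟨hxy.symm, hy⟩
      rw [(Prod.mk.inj h).1] at this
      simp at this
    · rintro (⟨z, hz, -, hzim, rfl⟩ | ⟨l, hl, -, hlim, -⟩)
      · have hinj : Set.InjOn c (s.erase z) := by
          rw [← card_image_iff, hzim, card_erase_of_mem hi₀, card_erase_of_mem hz, hc]
        by_contra! hcon
        refine hxy (hinj (mem_coe.2 (mem_erase.2 ⟨?_, hx⟩)) (mem_coe.2 (mem_erase.2 ⟨?_, hy⟩)) hcxy)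
        · rintro rfl
          exact hcon.1 rfl
        · rintro rfl
          exact hcon.2 rfl
      · exact absurd ⟨l, hl, hlim⟩ ha
    · rintro (rfl | rfl)
      · exact .inl ⟨x, hx, hi₀, herase x hx y hy hxy hcxy, rfl⟩
      · exact .inl ⟨y, hy, hi₀, herase y hy x hx hxy.symm hcxy.symm, rfl⟩
  left
  rintro d (⟨x, hx, -, him, -⟩ | ⟨k, hk, -, him, -⟩)
  · have hins : s.image c = insert (c x) (C.erase i₀) := by
      rw [← him, ← image_insert, insert_erase hx]
    by_cases hxi : c x = i₀
    · exact hne (by rw [hins, hxi, insert_erase hi₀])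
    by_cases hxC : c x ∈ C
    · exact hb (by rw [hins, insert_eq_of_mem (mem_erase.2 ⟨hxi, hxC⟩)])
    · exact ha ⟨c x, hxC, by rw [hins, erase_insert_of_ne hxi]⟩
  · exact ha ⟨k, hk, him⟩

/-- **Scarf's lemma**, in its colorful form: for every coloring of a finite set carrying a family
of linear orders there is a nonempty dominated set that uses exactly its own indices as colors. -/
theorem exists_isDominated_image_eq [Finite S] [Nonempty S] [Finite I] [Nonempty I]
    [DecidableEq I] {r : I → S → ℕ} (hr : ∀ i, Function.Injective (r i)) (c : S → I) :
    ∃ (s : Finset S) (C : Finset I), IsDominated r s C ∧ #s = #C ∧ s.image c = C := by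
  classical
  have := Fintype.ofFinite S
  have := Fintype.ofFinite I
  obtain ⟨i₀⟩ := ‹Nonempty I›
  by_contra! hcon
  let doors : Finset (Finset S × Finset I) := {d | IsDominated r d.1 d.2 ∧ IsAlmostColored c i₀ d}
  let rooms : Finset (Finset S × Finset I) := {R | IsDominated r R.1 R.2 ∧ #R.1 = #R.2}
  have hcount := sum_card_bipartiteAbove_eq_sum_card_bipartiteBelow (s := doors) (t := rooms)
    IsDoorOf
  have hrooms : Even (∑ R ∈ rooms, #(bipartiteBelow IsDoorOf doors R)) := by
    refine even_sum _ fun R hR ↦ ?_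
    obtain ⟨-, hdom, hcard⟩ := mem_filter.1 hR
    have hmem : ∀ d, d ∈ bipartiteBelow IsDoorOf doors R ↔
        IsAlmostColored c i₀ d ∧ IsDoorOf d R := by
      intro d
      simp only [bipartiteBelow, doors, mem_filter, mem_univ, true_and]
      refine ⟨fun h ↦ ⟨h.1.2, h.2⟩, fun h ↦ ⟨⟨?_, h.1⟩, h.2⟩⟩
      rcases h.2 with ⟨x, -, rfl⟩ | ⟨k, -, rfl⟩
      · exact hdom.mono (subset_insert _ _) subset_rfl
      · exact hdom.mono subset_rfl (erase_subset _ _)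
    rcases almostColored_doors_of_room c i₀ hcard (hcon R.1 R.2 hdom hcard) with h | ⟨d₁, d₂, hne, h⟩
    · rw [card_eq_zero.2 (eq_empty_of_forall_notMem fun d hd ↦ h d ((hmem d).1 hd))]
      exact Even.zero
    · rw [show bipartiteBelow IsDoorOf doors R = {d₁, d₂} by
        ext d; rw [hmem, h]; simp, card_pair hne]
      exact even_two
  have hmem : ∀ d R, R ∈ bipartiteAbove IsDoorOf rooms d ↔
      IsDominated r R.1 R.2 ∧ #R.1 = #R.2 ∧ IsDoorOf d R := by
    simp [bipartiteAbove, rooms, and_assoc]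
  have hmem₀ : ((∅, {i₀}) : Finset S × Finset I) ∈ doors := by
    refine mem_filter.2 ⟨mem_univ _, fun y ↦ ⟨i₀, by simp⟩, by simp [IsAlmostColored]⟩
  have hdoors : Odd (∑ d ∈ doors, #(bipartiteAbove IsDoorOf rooms d)) := by
    rw [← add_sum_erase _ _ hmem₀]
    refine Odd.add_even ?_ (even_sum _ fun d hd ↦ ?_)
    · obtain ⟨R₁, h⟩ := exists_unique_room_of_empty hr i₀
      rw [show bipartiteAbove IsDoorOf rooms (∅, {i₀}) = {R₁} by
        ext R; rw [hmem, h]; simp, card_singleton]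
      exact odd_one
    · obtain ⟨hne, hd⟩ := mem_erase.1 hd
      obtain ⟨-, hdom, hcard, hi, him⟩ := mem_filter.1 hd
      have hs : d.1.Nonempty := by
        rw [nonempty_iff_ne_empty]
        intro he
        refine hne (Prod.ext he ?_)
        rw [he, image_empty] at him
        exact (insert_erase hi).symm.trans (by rw [← him]; rfl)
      obtain ⟨R₁, R₂, hne, h⟩ := exists_two_rooms hr hdom hcard hs
      rw [show bipartiteAbove IsDoorOf rooms d = {R₁, R₂} by
        ext R; rw [hmem, h]; simp, card_pair hne]
      exact even_two
  rw [hcount] at hdoors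
  exact Nat.not_even_iff_odd.2 hdoors hrooms

end Scarf

section Brouwer

open Filter Topology

/-- For every coloring of the lattice points of a dilated simplex there is a lattice point
such that each color either appears nearby or has a small coordinate there. -/
lemma exists_near_all_colors {I : Type*} [Fintype I] [Nonempty I] (N : ℕ) (c : (I → ℕ) → I) :
    ∃ z : I → ℕ, ∑ j, z j = N ∧ ∀ i, z i ≤ Fintype.card I ∨
      ∃ x : I → ℕ, ∑ j, x j = N ∧ c x = i ∧
        ∀ j, x j ≤ z j + Fintype.card I ∧ z j ≤ x j + Fintype.card I := by
  classical
  let S := {x : I → ℕ // x ∈ piAntidiag univ N}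
  let : Fintype S := inferInstanceAs (Fintype {x : I → ℕ // x ∈ piAntidiag univ N})
  have hsum : ∀ x : S, ∑ j, x.1 j = N := fun x ↦ (mem_piAntidiag.1 x.2).1
  obtain ⟨i₀⟩ := ‹Nonempty I›
  have hmem : ∀ x : I → ℕ, ∑ j, x j = N → x ∈ piAntidiag univ N := fun x hx ↦
    mem_piAntidiag.2 ⟨hx, by simp⟩
  have : Nonempty S := ⟨⟨Pi.single i₀ N, hmem _ (by simp)⟩⟩
  have : Nonempty I := ⟨i₀⟩
  let e := Fintype.equivFin S
  let r : I → S → ℕ := fun i x ↦ x.1 i * Fintype.card S + e x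
  have hlt : ∀ i (x y : S), x.1 i < y.1 i → r i x < r i y := by
    intro i x y hxy
    have h1 : (e x : ℕ) < Fintype.card S := (e x).2
    have h2 : (x.1 i + 1) * Fintype.card S ≤ y.1 i * Fintype.card S := by gcongr; exact hxy
    simp only [r]
    linarith
  have hr : ∀ i, Function.Injective (r i) := by
    intro i x y hxy
    have hi : x.1 i = y.1 i := by
      rcases lt_trichotomy (x.1 i) (y.1 i) with h | h | h
      · exact absurd hxy (hlt i x y h).ne
      · exact h
      · exact absurd hxy (hlt i y x h).ne'
    simp only [r, hi, add_right_inj] at hxy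
    exact e.injective (Fin.ext hxy)
  obtain ⟨s, C, hdom, hcard, him⟩ := exists_isDominated_image_eq hr (fun x : S ↦ c x.1)
  have hs : s.Nonempty := by
    obtain ⟨i, hi, -⟩ := hdom (Classical.arbitrary S)
    exact card_pos.1 (hcard ▸ card_pos.2 ⟨i, hi⟩)
  choose m hm hmle using fun i ↦ s.exists_min_image (fun x ↦ x.1 i) hs
  have hsmall : N < ∑ i ∈ C, ((m i).1 i + 1) := by
    by_contra! hle
    let y : I → ℕ := fun i ↦ (if i ∈ C then (m i).1 i + 1 else 0) +
      if i = i₀ then N - ∑ i ∈ C, ((m i).1 i + 1) else 0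
    have hy : ∑ j, y j = N := by
      simp only [y, sum_add_distrib, sum_ite_mem, univ_inter, sum_ite_eq', mem_univ, if_true]
      rw [← sum_add_distrib]
      omega
    obtain ⟨i, hi, hle⟩ := hdom ⟨y, hmem y hy⟩
    refine (hle (m i) (hm i)).not_gt (hlt i _ _ ?_)
    simp only [y, hi, if_true]
    omega
  have hCcard : #C ≤ Fintype.card I := card_le_univ C
  rw [sum_add_distrib, sum_const, smul_eq_mul, mul_one] at hsmall
  have hC : ∀ x ∈ s, ∀ i ∈ C, x.1 i ≤ (m i).1 i + #C := by
    intro x hx i hi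
    have h1 : ∑ j ∈ C, x.1 j ≤ N := (sum_le_sum_of_subset (subset_univ C)).trans (hsum x).le
    have h2 : ∑ j ∈ C.erase i, (m j).1 j ≤ ∑ j ∈ C.erase i, x.1 j :=
      sum_le_sum fun j _ ↦ hmle j x hx
    rw [← add_sum_erase _ _ hi] at h1 hsmall
    omega
  have hnC : ∀ x ∈ s, ∀ i ∉ C, x.1 i ≤ #C := by
    intro x hx i hi
    have h1 : ∑ j ∈ insert i C, x.1 j ≤ N :=
      (sum_le_sum_of_subset (subset_univ _)).trans (hsum x).le
    have h2 : ∑ j ∈ C, (m j).1 j ≤ ∑ j ∈ C, x.1 j := sum_le_sum fun j _ ↦ hmle j x hx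
    rw [sum_insert hi] at h1
    omega
  have hclose : ∀ x ∈ s, ∀ y ∈ s, ∀ i, x.1 i ≤ y.1 i + Fintype.card I := by
    intro x hx y hy i
    by_cases hi : i ∈ C
    · have h1 := hC x hx i hi
      have h2 := hmle i y hy
      omega
    · have h1 := hnC x hx i hi
      omega
  obtain ⟨z, hz⟩ := hs
  refine ⟨z.1, hsum z, fun i ↦ ?_⟩
  by_cases hi : i ∈ C
  · obtain ⟨x, hx, hxi⟩ := mem_image.1 (him ▸ hi : i ∈ s.image fun x : S ↦ c x.1)
    exact .inr ⟨x.1, hsum x, hxi, fun j ↦ ⟨hclose x hx z hz j, hclose z hz x hx j⟩⟩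
  · exact .inl ((hnC z hz i hi).trans hCcard)

/-- **Brouwer's fixed point theorem** for the standard simplex. -/
theorem exists_fixedPoint_stdSimplex {I : Type*} [Fintype I] [Nonempty I]
    {f : (I → ℝ) → I → ℝ} (hf : ContinuousOn f (stdSimplex ℝ I))
    (hmap : Set.MapsTo f (stdSimplex ℝ I) (stdSimplex ℝ I)) :
    ∃ x ∈ stdSimplex ℝ I, f x = x := by
  have hcol : ∀ x ∈ stdSimplex ℝ I, ∃ i, x i ≤ f x i := by
    intro x hx
    by_contra! hlt
    have := sum_lt_sum_of_nonempty univ_nonempty fun i _ ↦ hlt i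
    rw [hx.2, (hmap hx).2] at this
    exact lt_irrefl _ this
  let scale : ℕ → (I → ℕ) → I → ℝ := fun k x i ↦ x i / (k + 1 : ℝ)
  have hscale : ∀ k (x : I → ℕ), ∑ j, x j = k + 1 → scale k x ∈ stdSimplex ℝ I := by
    intro k x hx
    refine ⟨fun i ↦ by positivity, ?_⟩
    simp only [scale]
    rw [← sum_div, ← Nat.cast_sum, hx, Nat.cast_succ, div_self (by positivity)]
  have hc : ∀ k, ∃ c : (I → ℕ) → I, ∀ x, ∑ j, x j = k + 1 →
      scale k x (c x) ≤ f (scale k x) (c x) := by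
    intro k
    have : ∀ x : I → ℕ, ∃ i, ∑ j, x j = k + 1 → scale k x i ≤ f (scale k x) i := by
      intro x
      by_cases hx : ∑ j, x j = k + 1
      · obtain ⟨i, hi⟩ := hcol _ (hscale k x hx)
        exact ⟨i, fun _ ↦ hi⟩
      · exact ⟨Classical.arbitrary I, fun h ↦ absurd h hx⟩
    choose c hc using this
    exact ⟨c, hc⟩
  choose c hc using hc
  choose z hzsum hz using fun k ↦ exists_near_all_colors (k + 1) (c k)
  obtain ⟨x, hx, φ, hφ, hlim⟩ := (isCompact_stdSimplex ℝ I).tendsto_subseq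
    fun k ↦ hscale k (z k) (hzsum k)
  have hsmall : Tendsto (fun k ↦ (Fintype.card I : ℝ) / ((φ k : ℕ) + 1 : ℝ)) atTop (𝓝 0) :=
    (tendsto_const_div_atTop_nhds_zero_nat (Fintype.card I : ℝ)).comp
      ((tendsto_add_atTop_nat 1).comp hφ.tendsto_atTop) |>.congr fun k ↦ by simp
  have hle : ∀ i, x i ≤ f x i := by
    intro i
    by_contra! hlt
    have hpos : 0 < x i := ((hmap hx).1 i).trans_lt hlt
    have hev : ∀ᶠ y in 𝓝[stdSimplex ℝ I] x, f y i < y i := by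
      have h1 : Tendsto (fun y ↦ f y i) (𝓝[stdSimplex ℝ I] x) (𝓝 (f x i)) :=
        ((continuous_apply i).tendsto _).comp (hf x hx)
      have h2 : Tendsto (fun y : I → ℝ ↦ y i) (𝓝[stdSimplex ℝ I] x) (𝓝 (x i)) :=
        ((continuous_apply i).tendsto x).mono_left nhdsWithin_le_nhds
      exact h1.eventually_lt h2 hlt
    obtain ⟨ε, hε, hball⟩ := Metric.mem_nhdsWithin_iff.1 hev
    have hlim_i : Tendsto (fun k ↦ scale (φ k) (z (φ k)) i) atTop (𝓝 (x i)) :=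
      ((continuous_apply i).tendsto x).comp hlim
    have hd := Metric.tendsto_nhds.1 hlim (ε / 2) (by positivity)
    obtain ⟨k, hk₁, hk₂, hk₃⟩ := (hd.and ((hsmall.eventually_lt hlim_i hpos).and
      (hsmall.eventually_lt_const (show 0 < ε / 2 by positivity)))).exists
    have hk0 : (0 : ℝ) < (φ k : ℝ) + 1 := by positivity
    rcases hz (φ k) i with h | ⟨y, hy, rfl, hyz⟩
    · refine hk₂.not_ge ?_
      simp only [scale]
      gcongr
    · have hmem := hscale (φ k) y hy
      have hdist : dist (scale (φ k) y) (scale (φ k) (z (φ k))) ≤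
          (Fintype.card I : ℝ) / ((φ k : ℕ) + 1 : ℝ) := by
        refine (dist_pi_le_iff (by positivity)).2 fun j ↦ ?_
        obtain ⟨h1, h2⟩ := hyz j
        have h1' : (y j : ℝ) ≤ z (φ k) j + Fintype.card I := by exact_mod_cast h1
        have h2' : (z (φ k) j : ℝ) ≤ y j + Fintype.card I := by exact_mod_cast h2
        simp only [scale]
        rw [Real.dist_eq, ← sub_div, abs_div, abs_of_pos hk0]
        gcongr
        rw [abs_le]
        constructor <;> linarith
      have hdx : dist (scale (φ k) y) x < ε := by
        have := dist_triangle (scale (φ k) y) (scale (φ k) (z (φ k))) x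
        simp only [Function.comp_apply] at hk₁
        linarith
      exact (hc (φ k) y hy).not_gt (hball ⟨hdx, hmem⟩)
  refine ⟨x, hx, funext fun i ↦ ?_⟩
  have := (sum_eq_sum_iff_of_le fun i _ ↦ hle i).1 (hx.2.trans (hmap hx).2.symm)
  exact (this i (mem_univ i)).symm

end Brouwer

section Equilibrium

/-- **Brouwer's fixed point theorem** for a product of standard simplices. -/
theorem exists_fixedPoint_pi_stdSimplex {K : Type*} [Fintype K] [Nonempty K] {S : K → Type*}
    [∀ k, Fintype (S k)] [∀ k, Nonempty (S k)] {f : (∀ k, S k → ℝ) → ∀ k, S k → ℝ}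
    (hf : ContinuousOn f {x | ∀ k, x k ∈ stdSimplex ℝ (S k)})
    (hmap : ∀ x, (∀ k, x k ∈ stdSimplex ℝ (S k)) → ∀ k, f x k ∈ stdSimplex ℝ (S k)) :
    ∃ x, (∀ k, x k ∈ stdSimplex ℝ (S k)) ∧ f x = x := by
  set n : ℝ := (Fintype.card K : ℝ) with hn
  have hn0 : 0 < n := by simp [hn, Fintype.card_pos]
  let mass : ((Σ k, S k) → ℝ) → K → ℝ := fun x k ↦ ∑ a, x ⟨k, a⟩
  let ρ : ((Σ k, S k) → ℝ) → ∀ k, S k → ℝ := fun x k a ↦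
    (x ⟨k, a⟩ + (max (mass x k) n⁻¹ - mass x k) / Fintype.card (S k)) / max (mass x k) n⁻¹
  have hmax : ∀ x k, 0 < max (mass x k) n⁻¹ := fun x k ↦ lt_max_of_lt_right (by positivity)
  have hρc : Continuous ρ := by
    refine continuous_pi fun k ↦ continuous_pi fun a ↦ ?_
    have hmc : Continuous fun x ↦ mass x k := by fun_prop
    exact Continuous.div (by fun_prop) (by fun_prop) fun x ↦ (hmax x k).ne'
  have hρ : ∀ x ∈ stdSimplex ℝ (Σ k, S k), ∀ k, ρ x k ∈ stdSimplex ℝ (S k) := by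
    intro x hx k
    refine ⟨fun a ↦ ?_, ?_⟩
    · have h1 := hx.1 ⟨k, a⟩
      have h2 : 0 ≤ max (mass x k) n⁻¹ - mass x k := sub_nonneg.2 (le_max_left _ _)
      have := hmax x k
      simp only [ρ]
      positivity
    · simp only [ρ]
      rw [← sum_div, sum_add_distrib, sum_const, card_univ, nsmul_eq_mul,
        mul_div_cancel₀ _ (by simp), div_eq_one_iff_eq (hmax x k).ne']
      simp only [mass]
      ring
  have : Nonempty (Σ k, S k) := ⟨⟨Classical.arbitrary K, Classical.arbitrary _⟩⟩
  obtain ⟨x, hx, hfix⟩ := exists_fixedPoint_stdSimplex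
    (f := fun x (p : Σ k, S k) ↦ n⁻¹ * f (ρ x) p.1 p.2) (I := Σ k, S k) (by
      have h : ContinuousOn (fun x ↦ f (ρ x)) (stdSimplex ℝ (Σ k, S k)) :=
        hf.comp hρc.continuousOn hρ
      refine continuousOn_pi.2 fun p ↦ continuousOn_const.mul ?_
      exact continuousOn_pi.1 (continuousOn_pi.1 h p.1) p.2) (by
      intro x hx
      have h := hmap _ (hρ x hx)
      refine ⟨fun p ↦ mul_nonneg (by positivity) ((h p.1).1 p.2), ?_⟩
      rw [← mul_sum, Fintype.sum_sigma]
      simp only [(h _).2, sum_const, card_univ, nsmul_eq_mul, mul_one]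
      exact inv_mul_cancel₀ hn0.ne')
  have hfix' : ∀ k a, n⁻¹ * f (ρ x) k a = x ⟨k, a⟩ := fun k a ↦ congrFun hfix ⟨k, a⟩
  have hmass : ∀ k, mass x k = n⁻¹ := fun k ↦ by
    simp only [mass, ← hfix']
    rw [← mul_sum, (hmap _ (hρ x hx) k).2, mul_one]
  refine ⟨ρ x, hρ x hx, ?_⟩
  ext k a
  simp only [ρ, hmass k, max_self, sub_self, zero_div, add_zero]
  rw [← hfix' k a]
  exact (mul_div_cancel_left₀ _ (inv_ne_zero hn0.ne')).symm

/-- In a game with finitely many agents, each having a continuous vector of payoffs, some mixed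
profile gives no agent a pure action that beats the average payoff. -/
theorem exists_forall_le_average {K : Type*} [Finite K] {S : K → Type*}
    [∀ k, Fintype (S k)] [∀ k, Nonempty (S k)] {W : (∀ k, S k → ℝ) → ∀ k, S k → ℝ}
    (hW : Continuous W) :
    ∃ x, (∀ k, x k ∈ stdSimplex ℝ (S k)) ∧ ∀ k b, W x k b ≤ ∑ a, x k a * W x k a := by
  have := Fintype.ofFinite K
  rcases isEmpty_or_nonempty K with hK | hK
  · exact ⟨isEmptyElim, isEmptyElim, isEmptyElim⟩
  let gain : (∀ k, S k → ℝ) → ∀ k, S k → ℝ := fun x k b ↦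
    max 0 (W x k b - ∑ a, x k a * W x k a)
  have hgain0 : ∀ x k b, 0 ≤ gain x k b := fun x k b ↦ le_max_left _ _
  have hgain : ∀ k b, Continuous fun x ↦ gain x k b := by
    intro k b
    simp only [gain]
    fun_prop
  have hden : ∀ x k, 0 < 1 + ∑ a, gain x k a := fun x k ↦
    add_pos_of_pos_of_nonneg one_pos (sum_nonneg fun a _ ↦ hgain0 x k a)
  obtain ⟨x, hx, hfix⟩ := exists_fixedPoint_pi_stdSimplex
    (f := fun x k b ↦ (x k b + gain x k b) / (1 + ∑ a, gain x k a))
    (by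
      refine Continuous.continuousOn (continuous_pi fun k ↦ continuous_pi fun b ↦ ?_)
      exact Continuous.div (by fun_prop) (by fun_prop) fun x ↦ (hden x k).ne')
    (by
      intro x hx k
      refine ⟨fun b ↦ div_nonneg (add_nonneg ((hx k).1 b) (hgain0 x k b)) (hden x k).le, ?_⟩
      rw [← sum_div, sum_add_distrib, (hx k).2, div_self (hden x k).ne'])
  refine ⟨x, hx, fun k b ↦ ?_⟩
  have heq : ∀ a, gain x k a = x k a * ∑ b, gain x k b := by
    intro a
    have h : (x k a + gain x k a) / (1 + ∑ b, gain x k b) = x k a := congrFun (congrFun hfix k) a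
    rw [div_eq_iff (hden x k).ne'] at h
    linarith
  have hzero : ∑ b, gain x k b = 0 := by
    by_contra hne
    have hpos : 0 < ∑ b, gain x k b :=
      (sum_nonneg fun a _ ↦ hgain0 x k a).lt_of_ne' hne
    have hlt : ∀ a, 0 < x k a → ∑ a, x k a * W x k a < W x k a := by
      intro a ha
      have : 0 < gain x k a := heq a ▸ mul_pos ha hpos
      exact sub_pos.1 ((lt_max_iff.1 this).resolve_left (lt_irrefl _))
    have hex : ∃ a, 0 < x k a := by
      by_contra! hle
      have := sum_nonpos fun a (_ : a ∈ univ) ↦ hle a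
      rw [(hx k).2] at this
      exact this.not_gt one_pos
    have : ∑ a, x k a * ∑ b, x k b * W x k b < ∑ a, x k a * W x k a := by
      refine sum_lt_sum (fun a _ ↦ ?_) ?_
      · rcases ((hx k).1 a).eq_or_lt with h | h
        · simp [← h]
        · exact mul_le_mul_of_nonneg_left (hlt a h).le h.le
      · obtain ⟨a, ha⟩ := hex
        exact ⟨a, mem_univ a, mul_lt_mul_of_pos_left (hlt a ha) ha⟩
    rw [← sum_mul, (hx k).2, one_mul] at this
    exact lt_irrefl _ this
  have hb : gain x k b = 0 := by rw [heq, hzero, mul_zero]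
  exact sub_nonpos.1 (max_eq_left_iff.1 hb)

/-- Expected utility is linear in a player's own behavioral strategy. -/
lemma bayesExpUtil_update {m : ℕ} {T A : Fin m → Type*}
    [∀ i, Fintype (T i)] [∀ i, Fintype (A i)] [∀ i, DecidableEq (T i)] [∀ i, DecidableEq (A i)]
    (p : (∀ i, T i) → ℝ) (u : Fin m → (∀ i, T i) → (∀ i, A i) → ℝ)
    (σ : ∀ i, T i → A i → ℝ) (i : Fin m) (τ : T i → A i → ℝ) :
    bayesExpUtil p u (Function.update σ i τ) i = ∑ s, ∑ b, τ s b *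
      bayesExpUtil p u (Function.update σ i (Pi.single s (Pi.single b 1))) i := by
  have hprod : ∀ (τ : T i → A i → ℝ) (t : ∀ j, T j) (a : ∀ j, A j),
      ∏ j, Function.update σ i τ j (t j) (a j) =
        τ (t i) (a i) * ∏ j ∈ univ.erase i, σ j (t j) (a j) := by
    intro τ t a
    rw [← mul_prod_erase _ _ (mem_univ i), Function.update_self]
    congr 1
    refine prod_congr rfl fun j hj ↦ ?_
    rw [Function.update_of_ne (ne_of_mem_erase hj)]
  have hsingle : ∀ (t : T i) (a : A i),
      τ t a = ∑ s, ∑ b, τ s b * (Pi.single s (Pi.single b 1) : T i → A i → ℝ) t a := by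
    intro t a
    rw [sum_eq_single t, sum_eq_single a]
    · simp
    · intro b _ hb
      simp [hb.symm]
    · simp
    · intro s _ hs
      simp [Pi.single_eq_of_ne hs.symm]
    · simp
  have hcomm : ∀ F : T i → A i → (∀ j, T j) → (∀ j, A j) → ℝ,
      ∑ s, ∑ b, ∑ t, ∑ a, F s b t a = ∑ t, ∑ a, ∑ s, ∑ b, F s b t a := fun F ↦ calc
    _ = ∑ s, ∑ t, ∑ b, ∑ a, F s b t a := sum_congr rfl fun _ _ ↦ sum_comm
    _ = ∑ t, ∑ s, ∑ b, ∑ a, F s b t a := sum_comm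
    _ = ∑ t, ∑ s, ∑ a, ∑ b, F s b t a :=
      sum_congr rfl fun _ _ ↦ sum_congr rfl fun _ _ ↦ sum_comm
    _ = _ := sum_congr rfl fun _ _ ↦ sum_comm
  simp only [bayesExpUtil, hprod, mul_sum]
  rw [hcomm]
  refine sum_congr rfl fun t _ ↦ sum_congr rfl fun a _ ↦ ?_
  rw [hsingle (t i) (a i)]
  simp only [sum_mul, mul_sum]
  refine sum_congr rfl fun s _ ↦ sum_congr rfl fun b _ ↦ ?_
  ring

end Equilibrium

/-- Every finite Bayesian game has a Nash equilibrium in behavioral strategies. -/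
theorem exists_bayesian_nash_equilibrium
    (m : ℕ) (T A : Fin m → Type*)
    [∀ i, Fintype (T i)] [∀ i, Nonempty (T i)]
    [∀ i, Fintype (A i)] [∀ i, Nonempty (A i)]
    (p : (∀ i, T i) → ℝ) (hp : IsDist p)
    (u : Fin m → (∀ i, T i) → (∀ i, A i) → ℝ) :
    ∃ σ : ∀ i, T i → A i → ℝ, (∀ i, IsBehavioral (σ i)) ∧
      ∀ (i : Fin m) (σ'i : T i → A i → ℝ), IsBehavioral σ'i →
        bayesExpUtil p u σ i ≥ bayesExpUtil p u (Function.update σ i σ'i) i := by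
  classical
  let strat : (∀ k : Σ i, T i, A k.1 → ℝ) → ∀ i, T i → A i → ℝ := fun x i t ↦ x ⟨i, t⟩
  let W : (∀ k : Σ i, T i, A k.1 → ℝ) → ∀ k : Σ i, T i, A k.1 → ℝ := fun x k b ↦
    bayesExpUtil p u (Function.update (strat x) k.1 (Pi.single k.2 (Pi.single b 1))) k.1
  have hW : Continuous W := by
    refine continuous_pi fun k ↦ continuous_pi fun b ↦ ?_
    have hs : Continuous strat := by fun_prop
    have hu : Continuous fun x ↦
        Function.update (strat x) k.1 (Pi.single k.2 (Pi.single b 1)) :=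
      hs.update k.1 continuous_const
    have hu' : ∀ j t a, Continuous fun x ↦
        Function.update (strat x) k.1 (Pi.single k.2 (Pi.single b 1)) j t a := fun j t a ↦
      (continuous_apply a).comp ((continuous_apply t).comp ((continuous_apply j).comp hu))
    simp only [W, bayesExpUtil]
    exact continuous_finsetSum _ fun t _ ↦ continuous_const.mul <|
      continuous_finsetSum _ fun a _ ↦ (continuous_finsetProd _ fun j _ ↦ hu' _ _ _).mul
        continuous_const
  obtain ⟨x, hx, hbest⟩ := exists_forall_le_average hW
  refine ⟨strat x, fun i t ↦ hx ⟨i, t⟩, fun i τ hτ ↦ ?_⟩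
  have hself := bayesExpUtil_update p u (strat x) i (strat x i)
  rw [Function.update_eq_self] at hself
  rw [ge_iff_le, hself, bayesExpUtil_update p u (strat x) i τ]
  refine sum_le_sum fun t _ ↦ ?_
  calc ∑ b, τ t b * W x ⟨i, t⟩ b
      ≤ ∑ b, τ t b * ∑ a, x ⟨i, t⟩ a * W x ⟨i, t⟩ a :=
        sum_le_sum fun b _ ↦ mul_le_mul_of_nonneg_left (hbest ⟨i, t⟩ b) ((hτ t).1 b)
    _ = ∑ a, x ⟨i, t⟩ a * W x ⟨i, t⟩ a := by rw [← sum_mul, (hτ t).2, one_mul]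
end

section
/- Every nonnegative computable real number has a computable square root: if r is a computable real and r ≥ 0, then √r is a computable real. -/
/-- A real number `r` is computable if some computable sequence of rationals
approximates it to within `2 ^ (-n)` for every `n`. -/
def ComputableReal (r : ℝ) : Prop :=
  ∃ f : ℕ → ℚ, Computable f ∧ ∀ n : ℕ, |r - (f n : ℝ)| ≤ 2 ^ (-(n : ℤ))

open Encodable

/-- Unbounded search for a decidable predicate that always has a witness is computable. -/
theorem Computable.nat_find {α : Type*} [Primcodable α] {P : α → ℕ → Prop}
    [∀ a, DecidablePred (P a)] (hP : Computable₂ fun a n => decide (P a n))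
    (h : ∀ a, ∃ n, P a n) : Computable fun a => Nat.find (h a) := by
  refine (Partrec.rfind (p := fun a n => Part.some (decide (P a n))) hP.partrec₂).of_eq_tot
    fun a => ?_
  refine Nat.mem_rfind.mpr ⟨?_, fun {m} hm => ?_⟩
  · simpa using Nat.find_spec (h a)
  · simpa using Nat.find_min (h a) hm

/-- The increasing enumeration of an infinite decidable set of naturals is computable. -/
theorem Nat.Subtype.computable_coe_ofNat {s : Set ℕ} [DecidablePred (· ∈ s)] [Infinite s]
    (hs : Computable fun n => decide (n ∈ s)) :
    Computable fun n => (Nat.Subtype.ofNat s n : ℕ) := by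
  have hex (x : ℕ) : ∃ m, x + m + 1 ∈ s := by
    obtain ⟨y, hy, hxy⟩ := (Set.infinite_coe_iff.mp ‹Infinite s›).exists_gt x
    exact ⟨y - x - 1, by rwa [show x + (y - x - 1) + 1 = y by omega]⟩
  have hfind : Computable fun x => Nat.find (hex x) :=
    Computable.nat_find (P := fun x m => x + m + 1 ∈ s)
      (hs.comp (Computable.succ.comp Primrec.nat_add.to_comp)) hex
  have hstep : Computable fun x => x + Nat.find (hex x) + 1 :=
    Computable.succ.comp (Primrec.nat_add.to_comp.comp Computable.id hfind)
  refine (Computable.nat_rec (σ := ℕ) (f := fun n : ℕ => n)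
    (g := fun _ => ((⊥ : s) : ℕ)) (h := fun _ p => p.2 + Nat.find (hex p.2) + 1)
    Computable.id (Computable.const _)
    (hstep.comp (Computable.snd.comp Computable.snd)).to₂).of_eq fun n => ?_
  induction n with
  | zero => rfl
  | succ n ih =>
    simp only at ih ⊢
    rw [ih]
    rfl

theorem Denumerable.encode_ofNat_ofEncodableOfInfinite (α : Type*) [Encodable α] [Infinite α]
    [DecidablePred (· ∈ Set.range (encode (α := α)))] [Infinite (Set.range (encode (α := α)))]
    (n : ℕ) :
    encode (@Denumerable.ofNat α (ofEncodableOfInfinite α) n) =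
      (Nat.Subtype.ofNat (Set.range (encode (α := α))) n : ℕ) := by
  obtain rfl : ‹DecidablePred (· ∈ Set.range (encode (α := α)))› = decidableRangeEncode α :=
    Subsingleton.elim _ _
  rw [ofEncodableOfInfinite, Denumerable.ofEquiv_ofNat, Nat.Subtype.denumerable,
    Denumerable.ofEquiv_ofNat]
  change ((equivRangeEncode α ((equivRangeEncode α).symm _) : Set.range encode) : ℕ) = _
  rw [Equiv.apply_symm_apply, Denumerable.ofNat_nat]
  rfl

theorem Int.natAbs_eq_encode (z : ℤ) : z.natAbs = (encode z + 1) / 2 := by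
  cases z with
  | ofNat n => change n = (2 * n + 1) / 2; omega
  | negSucc n => change n + 1 = (2 * n + 1 + 1) / 2; omega

theorem Int.toNat_eq_encode (z : ℤ) : z.toNat = (1 - encode z % 2) * (encode z / 2) := by
  cases z with
  | ofNat n => change n = (1 - 2 * n % 2) * (2 * n / 2); simp
  | negSucc n => change 0 = (1 - (2 * n + 1) % 2) * ((2 * n + 1) / 2); simp [Nat.add_mod]

/-- Coprimality is a primitive recursive relation. -/
theorem PrimrecRel.nat_coprime : PrimrecRel Nat.Coprime := by
  have hdvd : PrimrecRel fun d n : ℕ => n % d = 0 :=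
    Primrec.eq.comp (Primrec.nat_mod.comp Primrec.snd Primrec.fst) (Primrec.const 0)
  have hbody : PrimrecRel fun (d : ℕ) (p : ℕ × ℕ) => ¬ (p.1 % d = 0 ∧ p.2 % d = 0) ∨ d = 1 :=
    PrimrecPred.or (PrimrecPred.not (PrimrecPred.and
        (hdvd.comp Primrec.fst (Primrec.fst.comp Primrec.snd))
        (hdvd.comp Primrec.fst (Primrec.snd.comp Primrec.snd))))
      (Primrec.eq.comp Primrec.fst (Primrec.const 1))
  refine (hbody.forall_mem_list.comp
    (f := fun p : ℕ × ℕ => List.range (p.1 + p.2 + 2)) (g := fun p => p) ?_ Primrec.id).of_eq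
      fun p => ?_
  · exact Primrec.list_range.comp (Primrec.succ.comp (Primrec.succ.comp Primrec.nat_add))
  · simp only [← Nat.dvd_iff_mod_eq_zero, List.mem_range]
    constructor
    · intro h
      have hg : Nat.gcd p.1 p.2 < p.1 + p.2 + 2 := by
        rcases Nat.eq_zero_or_pos p.1 with h0 | h0
        · rw [h0, Nat.gcd_zero_left]; omega
        · have := Nat.gcd_le_left p.2 h0; omega
      exact (h _ hg).resolve_left (not_not_intro ⟨Nat.gcd_dvd_left _ _, Nat.gcd_dvd_right _ _⟩)
    · intro h d _
      by_cases hd : d ∣ p.1 ∧ d ∣ p.2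
      · exact Or.inr (Nat.eq_one_of_dvd_coprimes h hd.1 hd.2)
      · exact Or.inl hd

namespace Rat

theorem encode_eq_pair (q : ℚ) : encode q = Nat.pair (encode q.num) q.den := rfl

theorem mem_range_encode_iff (m : ℕ) :
    m ∈ Set.range (encode (α := ℚ)) ↔
      0 < m.unpair.2 ∧ ((m.unpair.1 + 1) / 2).Coprime m.unpair.2 := by
  constructor
  · rintro ⟨q, rfl⟩
    rw [encode_eq_pair, Nat.unpair_pair, ← Int.natAbs_eq_encode]
    exact ⟨q.pos, q.reduced⟩
  · rintro ⟨hpos, hcop⟩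
    have henc : encode (Denumerable.ofNat ℤ m.unpair.1) = m.unpair.1 :=
      Denumerable.encode_ofNat _
    refine ⟨⟨Denumerable.ofNat ℤ m.unpair.1, m.unpair.2, hpos.ne', ?_⟩, ?_⟩
    · rwa [Int.natAbs_eq_encode, henc]
    · rw [encode_eq_pair]
      simp only [henc, Nat.pair_unpair]

/-- The pairing code of a rational is computable from the code that makes `ℚ` denumerable. -/
theorem computable_pair_num_den :
    Computable fun q : ℚ => Nat.pair (encode q.num) q.den := by
  classical
  let S := Set.range (encode (α := ℚ))
  have : Infinite S := Infinite.of_injective _ (Equiv.ofInjective _ encode_injective).injective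
  have hS : PrimrecPred (· ∈ S) := by
    have hfst : Primrec fun m : ℕ => m.unpair.1 := Primrec.fst.comp Primrec.unpair
    have hsnd : Primrec fun m : ℕ => m.unpair.2 := Primrec.snd.comp Primrec.unpair
    exact (PrimrecPred.and (Primrec.nat_lt.comp (Primrec.const 0) hsnd)
      (PrimrecRel.nat_coprime.comp (Primrec.nat_div.comp (Primrec.succ.comp hfst)
        (Primrec.const 2)) hsnd)).of_eq fun m => (mem_range_encode_iff m).symm
  refine ((Nat.Subtype.computable_coe_ofNat (s := S) hS.decide.to_comp).comp
    (Computable.encode (α := ℚ))).of_eq fun q => ?_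
  rw [← Denumerable.encode_ofNat_ofEncodableOfInfinite]
  change encode (Denumerable.ofNat ℚ (@encode ℚ Denumerable.toEncodable q)) = _
  rw [Denumerable.ofNat_encode, encode_eq_pair]

theorem computable_den : Computable Rat.den :=
  (Computable.snd.comp (Computable.unpair.comp computable_pair_num_den)).of_eq fun q => by simp

theorem computable_toNat_num : Computable fun q : ℚ => q.num.toNat := by
  have hz : Computable fun q : ℚ => encode q.num :=
    (Computable.fst.comp (Computable.unpair.comp computable_pair_num_den)).of_eq fun q => by simp
  have hp : Primrec fun z : ℕ => (1 - z % 2) * (z / 2) :=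
    Primrec.nat_mul.comp
      (Primrec.nat_sub.comp (Primrec.const 1) (Primrec.nat_mod.comp Primrec.id (Primrec.const 2)))
      (Primrec.nat_div.comp Primrec.id (Primrec.const 2))
  exact (hp.to_comp.comp hz).of_eq fun q => (Int.toNat_eq_encode _).symm

theorem cast_toNat_num_div_den (q : ℚ) : ((q.num.toNat : ℝ) / q.den) = max (q : ℝ) 0 := by
  have hd : (0 : ℝ) < q.den := by exact_mod_cast q.pos
  have hz : (q.num.toNat : ℝ) = max (q.num : ℝ) 0 := by
    exact_mod_cast congrArg (Int.cast (R := ℝ)) (Int.ofNat_toNat q.num)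
  rw [hz, ← max_div_div_right hd.le, zero_div, ← Rat.cast_def]

end Rat

/-- `(a / b) ^ 2` and `c / d` differ by less than `1 / e`, and `a` is positive; here the arguments
are the pairs `(a, b)` and `(c, d)` and the number `e`. -/
def SqApprox (x y : ℕ × ℕ) (e : ℕ) : Prop :=
  0 < x.1 ∧ x.1 ^ 2 * y.2 * e < (y.1 * e + y.2) * x.2 ^ 2 ∧
    y.1 * x.2 ^ 2 * e < (x.1 ^ 2 * e + x.2 ^ 2) * y.2

theorem primrecPred_sqApprox :
    PrimrecPred fun p : (ℕ × ℕ) × (ℕ × ℕ) × ℕ => SqApprox p.1 p.2.1 p.2.2 := by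
  have ha : Primrec fun p : (ℕ × ℕ) × (ℕ × ℕ) × ℕ => p.1.1 := Primrec.fst.comp Primrec.fst
  have hb : Primrec fun p : (ℕ × ℕ) × (ℕ × ℕ) × ℕ => p.1.2 := Primrec.snd.comp Primrec.fst
  have hc : Primrec fun p : (ℕ × ℕ) × (ℕ × ℕ) × ℕ => p.2.1.1 :=
    Primrec.fst.comp (Primrec.fst.comp Primrec.snd)
  have hd : Primrec fun p : (ℕ × ℕ) × (ℕ × ℕ) × ℕ => p.2.1.2 :=
    Primrec.snd.comp (Primrec.fst.comp Primrec.snd)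
  have he : Primrec fun p : (ℕ × ℕ) × (ℕ × ℕ) × ℕ => p.2.2 := Primrec.snd.comp Primrec.snd
  have ha2 := Primrec.nat_mul.comp ha ha
  have hb2 := Primrec.nat_mul.comp hb hb
  refine PrimrecPred.of_eq (PrimrecPred.and (Primrec.nat_lt.comp (Primrec.const 0) ha)
    (PrimrecPred.and
      (Primrec.nat_lt.comp (Primrec.nat_mul.comp (Primrec.nat_mul.comp ha2 hd) he)
        (Primrec.nat_mul.comp (Primrec.nat_add.comp (Primrec.nat_mul.comp hc he) hd) hb2))
      (Primrec.nat_lt.comp (Primrec.nat_mul.comp (Primrec.nat_mul.comp hc hb2) he)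
        (Primrec.nat_mul.comp (Primrec.nat_add.comp (Primrec.nat_mul.comp ha2 he) hb2) hd))))
    fun p => ?_
  simp only [SqApprox, pow_two]

theorem sqApprox_iff {a b c d e : ℕ} (hb : 0 < b) (hd : 0 < d) (he : 0 < e) :
    SqApprox (a, b) (c, d) e ↔
      0 < a ∧ |((a : ℝ) / b) ^ 2 - (c : ℝ) / d| < 1 / e := by
  have hb' : (0 : ℝ) < b := by exact_mod_cast hb
  have hd' : (0 : ℝ) < d := by exact_mod_cast hd
  have he' : (0 : ℝ) < e := by exact_mod_cast he
  rw [SqApprox, abs_sub_lt_iff, sub_lt_iff_lt_add, sub_lt_iff_lt_add, div_pow,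
    div_add_div _ _ he'.ne' hd'.ne', div_add_div _ _ he'.ne' (pow_pos hb' 2).ne',
    div_lt_div_iff₀ (pow_pos hb' 2) (mul_pos he' hd'),
    div_lt_div_iff₀ hd' (mul_pos he' (pow_pos hb' 2))]
  refine and_congr_right fun _ => and_congr ?_ ?_
  · rw [← Nat.cast_lt (α := ℝ)]
    push_cast
    constructor <;> intro h <;> linarith
  · rw [← Nat.cast_lt (α := ℝ)]
    push_cast
    constructor <;> intro h <;> linarith

/-- A nonnegative real has positive rationals with square arbitrarily close to it. -/
theorem exists_pos_rat_abs_sq_sub_lt {r ε : ℝ} (hr : 0 ≤ r) (hε : 0 < ε) :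
    ∃ q : ℚ, 0 < q ∧ |(q : ℝ) ^ 2 - r| < ε := by
  obtain ⟨q, hq, hq'⟩ := exists_rat_btwn
    (Real.sqrt_lt_sqrt hr (lt_add_of_pos_right r hε))
  have hq0 : (0 : ℝ) < q := (Real.sqrt_nonneg r).trans_lt hq
  refine ⟨q, by exact_mod_cast hq0, ?_⟩
  have h1 : r < (q : ℝ) ^ 2 := (Real.sqrt_lt' hq0).mp hq
  have h2 : (q : ℝ) ^ 2 < r + ε := (Real.lt_sqrt hq0.le).mp hq'
  rw [abs_lt]
  constructor <;> linarith

theorem abs_sqrt_sub_le_of_abs_sub_sq_le {r x δ : ℝ} (hr : 0 ≤ r) (hx : 0 ≤ x) (hδ : 0 ≤ δ)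
    (h : |r - x ^ 2| ≤ δ ^ 2) : |Real.sqrt r - x| ≤ δ := by
  have hs := Real.sqrt_nonneg r
  refine le_of_sq_le_sq ?_ hδ
  calc |Real.sqrt r - x| ^ 2 = |Real.sqrt r - x| * |Real.sqrt r - x| := sq _
    _ ≤ |Real.sqrt r - x| * |Real.sqrt r + x| := by
      refine mul_le_mul_of_nonneg_left ?_ (abs_nonneg _)
      rw [abs_of_nonneg (add_nonneg hs hx)]
      exact abs_sub_le_of_nonneg_of_le hs (by linarith) hx (by linarith)
    _ = |r - x ^ 2| := by
      rw [← abs_mul, mul_comm, ← sq_sub_sq, Real.sq_sqrt hr]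
    _ ≤ δ ^ 2 := h

/-- Every nonnegative computable real number has a computable square root. -/
theorem computableReal_sqrt (r : ℝ) (hr : ComputableReal r) (hr0 : 0 ≤ r) :
    ComputableReal (Real.sqrt r) := by
  classical
  obtain ⟨f, hf, hfr⟩ := hr
  let P : ℕ → ℕ → Prop := fun n i =>
    SqApprox ((Denumerable.ofNat ℚ i).num.toNat, (Denumerable.ofNat ℚ i).den)
      ((f (2 * n + 2)).num.toNat, (f (2 * n + 2)).den) (2 ^ (2 * n + 1))
  have hP_iff (n i : ℕ) : P n i ↔ 0 < Denumerable.ofNat ℚ i ∧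
      |(Denumerable.ofNat ℚ i : ℝ) ^ 2 - max (f (2 * n + 2) : ℝ) 0| < 1 / 2 ^ (2 * n + 1) := by
    simp only [P]
    rw [sqApprox_iff (Rat.pos _) (Rat.pos _) (by positivity), Rat.cast_toNat_num_div_den,
      Rat.cast_toNat_num_div_den, Int.lt_toNat, Nat.cast_zero, Rat.num_pos]
    push_cast
    refine and_congr_right fun hq => ?_
    rw [max_eq_left (by exact_mod_cast hq.le)]
  have hclose (n : ℕ) : |r - max (f (2 * n + 2) : ℝ) 0| ≤ 1 / 2 ^ (2 * n + 2) := by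
    calc |r - max (f (2 * n + 2) : ℝ) 0| = |max r 0 - max (f (2 * n + 2) : ℝ) 0| := by
          rw [max_eq_left hr0]
      _ ≤ |r - f (2 * n + 2)| := abs_max_sub_max_le_abs _ _ _
      _ ≤ 1 / 2 ^ (2 * n + 2) := by
          refine (hfr _).trans_eq ?_
          rw [zpow_neg, zpow_natCast, one_div]
  have hhalf (n : ℕ) : (1 : ℝ) / 2 ^ (2 * n + 1) = 1 / 2 ^ (2 * n + 2) + 1 / 2 ^ (2 * n + 2) := by
    field_simp
    ring
  have hex (n : ℕ) : ∃ i, P n i := by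
    obtain ⟨q, hq, hqr⟩ := exists_pos_rat_abs_sq_sub_lt hr0
      (show (0 : ℝ) < 1 / 2 ^ (2 * n + 2) by positivity)
    refine ⟨@encode ℚ Denumerable.toEncodable q, (hP_iff _ _).mpr ?_⟩
    rw [Denumerable.ofNat_encode]
    refine ⟨hq, (abs_sub_le _ r _).trans_lt ?_⟩
    rw [hhalf]
    exact add_lt_add_of_lt_of_le hqr (hclose n)
  have hP : Computable₂ fun n i => decide (P n i) := by
    have hfrac : Computable fun q : ℚ => (q.num.toNat, q.den) :=
      Rat.computable_toNat_num.pair Rat.computable_den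
    have hk : Primrec fun n : ℕ => 2 * n + 1 := Primrec.nat_double_succ
    have hpow : Primrec fun n : ℕ => 2 ^ (2 * n + 1) :=
      (Primrec₂.unpaired'.mp Nat.Primrec.pow).comp (Primrec.const 2) hk
    have hk' : Primrec fun n : ℕ => 2 * n + 2 := Primrec.succ.comp hk
    have hx : Computable fun p : ℕ × ℕ =>
        ((Denumerable.ofNat ℚ p.2).num.toNat, (Denumerable.ofNat ℚ p.2).den) :=
      hfrac.comp ((Computable.ofNat ℚ).comp Computable.snd)
    have hy : Computable fun p : ℕ × ℕ =>
        ((f (2 * p.1 + 2)).num.toNat, (f (2 * p.1 + 2)).den) :=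
      hfrac.comp (hf.comp (hk'.to_comp.comp Computable.fst))
    have he : Computable fun p : ℕ × ℕ => 2 ^ (2 * p.1 + 1) := hpow.to_comp.comp Computable.fst
    refine (primrecPred_sqApprox.decide.to_comp.comp (hx.pair (hy.pair he))).of_eq fun p => ?_
    rfl
  refine ⟨fun n => Denumerable.ofNat ℚ (Nat.find (hex n)),
    (Computable.ofNat ℚ).comp (Computable.nat_find hP hex), fun n => ?_⟩
  obtain ⟨hq, hqr⟩ := (hP_iff n _).mp (Nat.find_spec (hex n))
  refine abs_sqrt_sub_le_of_abs_sub_sq_le hr0 (by exact_mod_cast hq.le) (by positivity) ?_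
  have hsq : ((2 : ℝ) ^ (-(n : ℤ))) ^ 2 = 1 / 2 ^ (2 * n + 1) + 1 / 2 ^ (2 * n + 1) := by
    rw [zpow_neg, zpow_natCast]
    field_simp
    ring
  rw [hsq]
  refine (abs_sub_le _ (max (f (2 * n + 2) : ℝ) 0) _).trans (add_le_add ?_ ?_)
  · rw [hhalf]
    exact (hclose n).trans (le_add_of_nonneg_left (by positivity))
  · rw [abs_sub_comm]
    exact hqr.le
end

section
/- Let N ≥ 1 and let 0 = s_0 ≤ s_1 ≤ ⋯ ≤ s_N = 1 be real numbers. Define g : (ℕ → Bool) → {1,…,N} by letting g(x) be the least k with val(x) ≤ s_k. Then (i) for each k ∈ {1,…,N}, μ({x : g(x) = k}) = s_k − s_{k−1}; and (ii) for μ-almost every x there exists n ∈ ℕ such that every y ∈ (ℕ → Bool) agreeing with x on the first n coordinates satisfies g(y) = g(x), i.e., with probability 1 the value of g is determined by a finite prefix of the coin tosses. -/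
open MeasureTheory

/-- The binary-expansion map: `val x = ∑ₙ xₙ 2^{-(n+1)}`. -/
noncomputable def binVal (x : ℕ → Bool) : ℝ :=
  ∑' n : ℕ, (if x n = true then (1 : ℝ) else 0) / 2 ^ (n + 1)

/-- A probability measure on `ℕ → Bool` is the fair-coin product measure if it
assigns probability `2^{-|s|}` to every cylinder determined by the coordinates
in a finite set `s`. -/
def IsFairCoinMeasure (μ : Measure (ℕ → Bool)) : Prop :=
  IsProbabilityMeasure μ ∧
    ∀ (s : Finset ℕ) (b : ℕ → Bool),
      μ {x | ∀ i ∈ s, x i = b i} = (1 / 2 : ENNReal) ^ s.card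

theorem summable_binVal (x : ℕ → Bool) :
    Summable fun n : ℕ => (if x n = true then (1 : ℝ) else 0) / 2 ^ (n + 1) := by
  refine Summable.of_nonneg_of_le (fun n => by positivity) (fun n => ?_)
    (summable_geometric_two' 1)
  rw [pow_succ', div_div]
  gcongr
  split_ifs <;> norm_num

theorem binVal_nonneg (x : ℕ → Bool) : 0 ≤ binVal x :=
  tsum_nonneg fun n => by positivity

theorem binVal_le_one (x : ℕ → Bool) : binVal x ≤ 1 := by
  rw [← tsum_geometric_two' 1]
  refine (summable_binVal x).tsum_le_tsum (fun n => ?_) (summable_geometric_two' 1)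
  rw [pow_succ', div_div]
  gcongr
  split_ifs <;> norm_num

theorem continuous_binVal : Continuous binVal := by
  refine continuous_tsum (u := fun n => (1 : ℝ) / 2 / 2 ^ n) (fun n => ?_)
    (summable_geometric_two' 1) (fun n x => ?_)
  · exact ((continuous_of_discreteTopology
      (f := fun b : Bool => (if b = true then (1 : ℝ) else 0))).comp
      (continuous_apply n)).div_const _
  · rw [Real.norm_of_nonneg (by positivity), pow_succ', div_div]
    gcongr
    split_ifs <;> norm_num

/-- The natural number whose binary digits are the first `n` bits of `x`, most significant
first. -/
def prefixNat (x : ℕ → Bool) : ℕ → ℕ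
  | 0 => 0
  | n + 1 => 2 * prefixNat x n + (x n).toNat

theorem binVal_eq_half (x : ℕ → Bool) :
    binVal x = ((x 0).toNat + binVal fun i => x (i + 1)) / 2 := by
  rw [binVal, (summable_binVal x).tsum_eq_zero_add, add_div, binVal, ← tsum_div_const]
  congr 1
  · cases x 0 <;> simp
  · exact tsum_congr fun n => by rw [pow_succ _ (n + 1), div_div]

theorem binVal_eq_prefixNat (x : ℕ → Bool) (n : ℕ) :
    binVal x = (prefixNat x n + binVal fun i => x (i + n)) / 2 ^ n := by
  induction n with
  | zero => simp [prefixNat]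
  | succ n ih =>
    rw [ih, binVal_eq_half fun i => x (i + n)]
    simp only [prefixNat, zero_add, add_assoc, add_comm 1 n]
    push_cast
    field_simp
    ring

theorem prefixNat_le_binVal (x : ℕ → Bool) (n : ℕ) : prefixNat x n ≤ 2 ^ n * binVal x := by
  rw [binVal_eq_prefixNat x n, mul_div_cancel₀ _ (by positivity)]
  linarith [binVal_nonneg fun i => x (i + n)]

theorem binVal_le_prefixNat (x : ℕ → Bool) (n : ℕ) : 2 ^ n * binVal x ≤ prefixNat x n + 1 := by
  rw [binVal_eq_prefixNat x n, mul_div_cancel₀ _ (by positivity)]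
  linarith [binVal_le_one fun i => x (i + n)]

theorem prefixNat_eq_iff (x y : ℕ → Bool) (n : ℕ) :
    prefixNat x n = prefixNat y n ↔ ∀ i < n, x i = y i := by
  induction n with
  | zero => simp [prefixNat]
  | succ n ih =>
    rw [Nat.forall_lt_succ_right, ← ih]
    simp only [prefixNat]
    cases x n <;> cases y n <;> simp <;> omega

theorem exists_prefixNat_eq (n j : ℕ) (hj : j < 2 ^ n) : ∃ b, prefixNat b n = j := by
  induction n generalizing j with
  | zero => exact ⟨fun _ => false, by simp [prefixNat]; omega⟩
  | succ n ih =>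
    obtain ⟨b, hb⟩ := ih (j / 2) (by rw [pow_succ] at hj; omega)
    refine ⟨Function.update b n (decide (j % 2 = 1)), ?_⟩
    have h : prefixNat (Function.update b n (decide (j % 2 = 1))) n = prefixNat b n :=
      (prefixNat_eq_iff _ _ n).2 fun i hi => Function.update_of_ne hi.ne _ _
    rw [prefixNat, h, hb, Function.update_self]
    rcases Nat.mod_two_eq_zero_or_one j with h | h <;> simp [h] <;> omega

theorem measurable_prefixNat (n : ℕ) : Measurable fun x => prefixNat x n := by
  induction n with
  | zero => exact measurable_const
  | succ n ih =>
    exact (ih.const_mul 2).add ((measurable_of_countable Bool.toNat).comp (measurable_pi_apply n))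

namespace IsFairCoinMeasure

variable {μ : Measure (ℕ → Bool)}

theorem measureReal_prefixNat_eq (hμ : IsFairCoinMeasure μ) (n j : ℕ) (hj : j < 2 ^ n) :
    μ.real {x | prefixNat x n = j} = 1 / 2 ^ n := by
  obtain ⟨b, rfl⟩ := exists_prefixNat_eq n j hj
  have h := hμ.2 (Finset.range n) b
  simp only [Finset.mem_range, Finset.card_range, ← prefixNat_eq_iff] at h
  simp [measureReal_def, h]

theorem measureReal_prefixNat_lt (hμ : IsFairCoinMeasure μ) (n k : ℕ) (hk : k ≤ 2 ^ n) :
    μ.real {x | prefixNat x n < k} = k / 2 ^ n := by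
  have := hμ.1
  induction k with
  | zero => simp
  | succ k ih =>
    have hU : {x | prefixNat x n < k + 1} = {x | prefixNat x n < k} ∪ {x | prefixNat x n = k} := by
      ext x
      simp only [Set.mem_ofPred_eq, Set.mem_union]
      omega
    rw [hU, measureReal_union, ih (by omega), hμ.measureReal_prefixNat_eq n k (by omega)]
    · push_cast
      ring
    · exact Set.disjoint_left.2 fun x h h' => (show prefixNat x n < k from h).ne h'
    · exact measurable_prefixNat n (measurableSet_singleton k)

theorem measureReal_prefixNat_lt_le (hμ : IsFairCoinMeasure μ) (n k : ℕ) :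
    μ.real {x | prefixNat x n < k} ≤ k / 2 ^ n := by
  have := hμ.1
  rcases le_total k (2 ^ n) with h | h
  · exact (hμ.measureReal_prefixNat_lt n k h).le
  · refine measureReal_le_one.trans ?_
    rw [one_le_div (by positivity)]
    exact_mod_cast h

theorem measureReal_eq_of_subset (hμ : IsFairCoinMeasure μ) {t : ℝ} (ht₀ : 0 ≤ t) (ht₁ : t ≤ 1)
    {A : Set (ℕ → Bool)} (hA : {x | binVal x < t} ⊆ A) (hA' : A ⊆ {x | binVal x ≤ t}) :
    μ.real A = t := by
  have := hμ.1
  have key (n : ℕ) : |μ.real A - t| ≤ 2 * (1 / 2) ^ n := by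
    have hp : (0 : ℝ) < 2 ^ n := by positivity
    have hfl : (⌊2 ^ n * t⌋₊ : ℝ) ≤ 2 ^ n * t := Nat.floor_le (by positivity)
    have hlt : 2 ^ n * t < ⌊2 ^ n * t⌋₊ + 1 := Nat.lt_floor_add_one _
    have hle : ⌊2 ^ n * t⌋₊ ≤ 2 ^ n :=
      Nat.floor_le_of_le (by push_cast; nlinarith)
    have hupper : μ.real A ≤ (⌊2 ^ n * t⌋₊ + 1 : ℕ) / 2 ^ n := by
      refine (measureReal_mono fun x hx => ?_).trans (hμ.measureReal_prefixNat_lt_le n _)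
      have hx' : binVal x ≤ t := hA' hx
      have h := prefixNat_le_binVal x n
      have : (prefixNat x n : ℝ) < (⌊2 ^ n * t⌋₊ + 1 : ℕ) := by push_cast; nlinarith
      exact_mod_cast this
    have hlower : ((⌊2 ^ n * t⌋₊ - 1 : ℕ) : ℝ) / 2 ^ n ≤ μ.real A := by
      rw [← hμ.measureReal_prefixNat_lt n _ (by omega)]
      refine measureReal_mono fun x hx => hA ?_
      have hx' : prefixNat x n + 1 < ⌊2 ^ n * t⌋₊ := by
        have : prefixNat x n < ⌊2 ^ n * t⌋₊ - 1 := hx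
        omega
      have hx'' : (prefixNat x n : ℝ) + 1 < ⌊2 ^ n * t⌋₊ := by exact_mod_cast hx'
      have h := binVal_le_prefixNat x n
      exact lt_of_mul_lt_mul_left (by linarith) hp.le
    have hsub : (⌊2 ^ n * t⌋₊ : ℝ) - 1 ≤ (⌊2 ^ n * t⌋₊ - 1 : ℕ) := by
      rw [sub_le_iff_le_add]
      exact_mod_cast le_tsub_add
    rw [le_div_iff₀ hp] at hupper
    rw [div_le_iff₀ hp] at hlower
    push_cast at hupper
    rw [one_div, inv_pow, ← div_eq_mul_inv, le_div_iff₀ hp, ← abs_of_pos hp, ← abs_mul, abs_le]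
    constructor <;> nlinarith
  have hlim : Filter.Tendsto (fun n : ℕ => 2 * (1 / 2 : ℝ) ^ n) Filter.atTop (nhds 0) := by
    simpa using (tendsto_pow_atTop_nhds_zero_of_lt_one (r := (1 / 2 : ℝ)) (by norm_num)
      (by norm_num)).const_mul 2
  exact sub_eq_zero.1 (abs_nonpos_iff.1 (ge_of_tendsto' hlim key))

theorem measureReal_binVal_le (hμ : IsFairCoinMeasure μ) {t : ℝ} (ht₀ : 0 ≤ t) (ht₁ : t ≤ 1) :
    μ.real {x | binVal x ≤ t} = t :=
  hμ.measureReal_eq_of_subset ht₀ ht₁ (fun x (h : binVal x < t) => h.le) subset_rfl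

theorem measureReal_binVal_lt (hμ : IsFairCoinMeasure μ) {t : ℝ} (ht₀ : 0 ≤ t) (ht₁ : t ≤ 1) :
    μ.real {x | binVal x < t} = t :=
  hμ.measureReal_eq_of_subset ht₀ ht₁ subset_rfl (fun x (h : binVal x < t) => h.le)

theorem ae_binVal_ne (hμ : IsFairCoinMeasure μ) {t : ℝ} (ht₀ : 0 ≤ t) (ht₁ : t ≤ 1) :
    ∀ᵐ x ∂μ, binVal x ≠ t := by
  have := hμ.1
  have hdiff : {x | ¬ binVal x ≠ t} = {x | binVal x ≤ t} \ {x | binVal x < t} := by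
    ext x
    simp only [ne_eq, not_not, Set.mem_ofPred_eq, Set.mem_sdiff, not_lt]
    exact le_antisymm_iff
  have hsub : {x | binVal x < t} ⊆ {x | binVal x ≤ t} := fun x (h : binVal x < t) => h.le
  rw [ae_iff, ← measureReal_eq_zero_iff, hdiff, measureReal_sdiff hsub
      (continuous_binVal.measurable measurableSet_Iio),
    hμ.measureReal_binVal_le ht₀ ht₁, hμ.measureReal_binVal_lt ht₀ ht₁, sub_self]

theorem measure_binVal_mem_Ioc (hμ : IsFairCoinMeasure μ) {a b : ℝ} (ha : 0 ≤ a) (hab : a ≤ b)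
    (hb : b ≤ 1) : μ {x | binVal x ∈ Set.Ioc a b} = ENNReal.ofReal (b - a) := by
  have := hμ.1
  have hdiff : {x | binVal x ∈ Set.Ioc a b} = {x | binVal x ≤ b} \ {x | binVal x ≤ a} := by
    ext x
    simp [and_comm]
  have hsub : {x | binVal x ≤ a} ⊆ {x | binVal x ≤ b} :=
    fun x (h : binVal x ≤ a) => h.trans hab
  rw [← ofReal_measureReal, hdiff, measureReal_sdiff hsub
      (continuous_binVal.measurable measurableSet_Iic),
    hμ.measureReal_binVal_le (ha.trans hab) hb, hμ.measureReal_binVal_le ha (hab.trans hb)]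

end IsFairCoinMeasure

theorem sInf_threshold_eq {N k : ℕ} {s : ℕ → ℝ} (hs : MonotoneOn s (Set.Iic N)) (hk : 1 ≤ k)
    (hkN : k ≤ N) {v : ℝ} (hv : v ∈ Set.Ioc (s (k - 1)) (s k)) :
    sInf {j : ℕ | 1 ≤ j ∧ v ≤ s j} = k := by
  refine IsLeast.csInf_eq ⟨⟨hk, hv.2⟩, fun j hj => ?_⟩
  by_contra! hjk
  have : s j ≤ s (k - 1) :=
    hs (Set.mem_Iic.2 (by omega)) (Set.mem_Iic.2 (by omega)) (by omega)
  linarith [hv.1, hj.2]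

theorem mem_Ioc_sInf_threshold {N : ℕ} {s : ℕ → ℝ} (hN : 1 ≤ N) {v : ℝ} (hv₀ : s 0 < v)
    (hvN : v ≤ s N) :
    sInf {j : ℕ | 1 ≤ j ∧ v ≤ s j} ∈ Set.Icc 1 N ∧
      v ∈ Set.Ioc (s (sInf {j : ℕ | 1 ≤ j ∧ v ≤ s j} - 1)) (s (sInf {j : ℕ | 1 ≤ j ∧ v ≤ s j})) := by
  have hNmem : N ∈ {j : ℕ | 1 ≤ j ∧ v ≤ s j} := ⟨hN, hvN⟩
  have hmem := Nat.sInf_mem ⟨N, hNmem⟩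
  refine ⟨⟨hmem.1, Nat.sInf_le hNmem⟩, ?_, hmem.2⟩
  by_contra! hle
  set k := sInf {j : ℕ | 1 ≤ j ∧ v ≤ s j} with hk
  rcases hmem.1.eq_or_lt with h1 | h1
  · rw [← h1] at hle
    exact hle.not_gt hv₀
  · have : k ≤ k - 1 := Nat.sInf_le ⟨by omega, hle⟩
    omega

/-- The sampling construction: given thresholds `0 = s₀ ≤ s₁ ≤ ⋯ ≤ s_N = 1`,
the rule outputting the least `k ≥ 1` with `val x ≤ s_k` outputs `k` with
probability `s_k - s_{k-1}`, and with probability 1 its output is determined by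
a finite prefix of the coin tosses. -/
theorem fairCoin_sampling (μ : Measure (ℕ → Bool)) (hμ : IsFairCoinMeasure μ)
    (N : ℕ) (hN : 1 ≤ N) (s : ℕ → ℝ)
    (hs0 : s 0 = 0) (hsN : s N = 1) (hmono : ∀ k < N, s k ≤ s (k + 1))
    (g : (ℕ → Bool) → ℕ)
    (hg : ∀ x, g x = sInf {k : ℕ | 1 ≤ k ∧ binVal x ≤ s k}) :
    (∀ k, 1 ≤ k → k ≤ N → μ {x | g x = k} = ENNReal.ofReal (s k - s (k - 1))) ∧
      (∀ᵐ x ∂μ, ∃ n : ℕ, ∀ y : ℕ → Bool, (∀ i < n, y i = x i) → g y = g x) := by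
  have hs : MonotoneOn s (Set.Iic N) :=
    monotoneOn_of_le_succ Set.ordConnected_Iic fun k _ _ hk => hmono k (Order.succ_le_iff.1 hk)
  have hs01 (k : ℕ) (hk : k ≤ N) : 0 ≤ s k ∧ s k ≤ 1 :=
    ⟨hs0 ▸ hs (Set.mem_Iic.2 N.zero_le) hk k.zero_le, hsN ▸ hs hk Set.self_mem_Iic hk⟩
  have hne : ∀ᵐ x ∂μ, ∀ k ≤ N, binVal x ≠ s k := by
    rw [ae_all_iff]
    intro k
    by_cases hk : k ≤ N
    · filter_upwards [hμ.ae_binVal_ne (hs01 k hk).1 (hs01 k hk).2] with x hx _ using hx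
    · exact .of_forall fun x h => absurd h hk
  have hgmem (x : ℕ → Bool) (hx : ∀ k ≤ N, binVal x ≠ s k) :
      g x ∈ Set.Icc 1 N ∧ binVal x ∈ Set.Ioc (s (g x - 1)) (s (g x)) := by
    rw [hg]
    refine mem_Ioc_sInf_threshold hN ?_ (hsN ▸ binVal_le_one x)
    exact (hs0 ▸ binVal_nonneg x).lt_of_ne' (hx 0 N.zero_le)
  refine ⟨fun k hk hkN => ?_, ?_⟩
  · rw [← hμ.measure_binVal_mem_Ioc (hs01 (k - 1) (by omega)).1
      (hs (Set.mem_Iic.2 (by omega)) hkN (Nat.sub_le k 1)) (hs01 k hkN).2]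
    refine measure_congr (Filter.eventuallyEq_set.2 ?_)
    filter_upwards [hne] with x hx
    exact ⟨fun (h : g x = k) => h ▸ (hgmem x hx).2,
      fun h => (hg x).trans (sInf_threshold_eq hs hk hkN h)⟩
  · filter_upwards [hne] with x hx
    obtain ⟨⟨hk, hkN⟩, hlo, hhi⟩ := hgmem x hx
    have hnhds : binVal ⁻¹' Set.Ioo (s (g x - 1)) (s (g x)) ∈ nhds x :=
      continuous_binVal.continuousAt (Ioo_mem_nhds hlo (hhi.lt_of_ne (hx _ hkN)))
    obtain ⟨U, ⟨z, n, rfl⟩, hxU, hU⟩ :=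
      (PiNat.isTopologicalBasis_cylinders fun _ => Bool).mem_nhds_iff.1 hnhds
    refine ⟨n, fun y hy => ?_⟩
    have hyU : y ∈ PiNat.cylinder z n := fun i hi => (hy i hi).trans (hxU i hi)
    exact (hg y).trans (sInf_threshold_eq hs hk hkN (Set.Ioo_subset_Ioc_self (hU hyU)))
end

section
/- The machine game version of rock-paper-scissors in which randomization is costly has no Nash equilibrium: let d < d′ be real numbers, and for σ ∈ Δ(Fin 3) let cost(σ) = d if σ is a point mass (assigns probability 1 to a single action) and cost(σ) = d′ otherwise. Define U_1(σ,τ) = Σ_{i,j} σ(i) τ(j) u(i,j) − cost(σ) and U_2(σ,τ) = −Σ_{i,j} σ(i) τ(j) u(i,j) − cost(τ). Then there is no pair (σ,τ) ∈ Δ(Fin 3) × Δ(Fin 3) such that σ maximizes U_1(·,τ) over Δ(Fin 3) and τ maximizes U_2(σ,·) over Δ(Fin 3). -/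
open Finset

/-- Rock-paper-scissors payoff to player 1: `u i j = 1` if `i = j + 1` (mod 3),
`-1` if `j = i + 1` (mod 3), and `0` otherwise. -/
def rpsPayoff (i j : Fin 3) : ℝ :=
  if i = j + 1 then 1 else if j = i + 1 then -1 else 0

/-- A mixed strategy is a point mass if it assigns probability 1 to a single action. -/
def IsPointMass {S : Type*} [Fintype S] (σ : S → ℝ) : Prop :=
  ∃ s, σ s = 1

open Classical in
/-- Cost of a strategy: `d` for deterministic (point-mass) strategies, `d'` for
randomized ones. -/
noncomputable def rpsCost (d d' : ℝ) (σ : Fin 3 → ℝ) : ℝ :=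
  if IsPointMass σ then d else d'

/-- Player 1's utility in the machine game: expected payoff minus complexity cost. -/
noncomputable def rpsU1 (d d' : ℝ) (σ τ : Fin 3 → ℝ) : ℝ :=
  (∑ i : Fin 3, ∑ j : Fin 3, σ i * τ j * rpsPayoff i j) - rpsCost d d' σ

/-- Player 2's utility in the machine game: expected payoff minus complexity cost. -/
noncomputable def rpsU2 (d d' : ℝ) (σ τ : Fin 3 → ℝ) : ℝ :=
  -(∑ i : Fin 3, ∑ j : Fin 3, σ i * τ j * rpsPayoff i j) - rpsCost d d' τ

theorem isDist_single {S : Type*} [Fintype S] [DecidableEq S] (s : S) :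
    IsDist (Pi.single s 1 : S → ℝ) := by
  refine ⟨fun t => ?_, by simp⟩
  by_cases h : t = s <;> simp [h]

theorem IsDist.eq_single {S : Type*} [Fintype S] [DecidableEq S] {μ : S → ℝ} (hμ : IsDist μ)
    {s : S} (hs : μ s = 1) : μ = Pi.single s 1 := by
  have hsum := Finset.add_sum_erase univ μ (mem_univ s)
  rw [hμ.2, hs, add_eq_left, Finset.sum_eq_zero_iff_of_nonneg fun t _ => hμ.1 t] at hsum
  ext t
  by_cases h : t = s
  · simp [h, hs]
  · simp [h, hsum t]

/-- An average is at most one of the averaged values. -/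
theorem IsDist.exists_sum_mul_le {S : Type*} [Fintype S] {μ : S → ℝ} (hμ : IsDist μ)
    (f : S → ℝ) : ∃ s, ∑ i, μ i * f i ≤ f s := by
  by_contra! h
  have heq : ∑ i, μ i * (∑ j, μ j * f j - f i) = 0 := by
    simp only [mul_sub, Finset.sum_sub_distrib, ← Finset.sum_mul, hμ.2, one_mul, sub_self]
  rw [Finset.sum_eq_zero_iff_of_nonneg
    fun i _ => mul_nonneg (hμ.1 i) (sub_nonneg.2 (h i).le)] at heq
  have hzero : ∀ i, μ i = 0 := fun i =>
    (mul_eq_zero.1 (heq i (mem_univ i))).resolve_right (sub_pos.2 (h i)).ne'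
  simpa [hzero] using hμ.2

theorem rpsCost_single (d d' : ℝ) (s : Fin 3) : rpsCost d d' (Pi.single s 1) = d :=
  if_pos ⟨s, by simp⟩

/-- When randomization is costly, a best response to linear payoffs is a point mass whose
payoff is at least that of every action. -/
theorem exists_eq_single_of_isMax {d d' : ℝ} (hdd' : d < d') {σ : Fin 3 → ℝ} (hσ : IsDist σ)
    (f : Fin 3 → ℝ)
    (hmax : ∀ σ' : Fin 3 → ℝ, IsDist σ' →
      ∑ i, σ' i * f i - rpsCost d d' σ' ≤ ∑ i, σ i * f i - rpsCost d d' σ) :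
    ∃ s, σ = Pi.single s 1 ∧ ∀ t, f t ≤ f s := by
  have hpure (t : Fin 3) : f t - d ≤ ∑ i, σ i * f i - rpsCost d d' σ := by
    simpa [rpsCost_single, Pi.single_apply] using hmax _ (isDist_single t)
  by_cases hp : IsPointMass σ
  · obtain ⟨s, hs⟩ := hp
    obtain rfl := hσ.eq_single hs
    refine ⟨s, rfl, fun t => ?_⟩
    simpa [rpsCost_single, Pi.single_apply] using hpure t
  · obtain ⟨s, hs⟩ := hσ.exists_sum_mul_le f
    have := hpure s
    rw [rpsCost, if_neg hp] at this
    linarith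

theorem rpsU1_eq (d d' : ℝ) (σ τ : Fin 3 → ℝ) :
    rpsU1 d d' σ τ = ∑ i, σ i * (∑ j, τ j * rpsPayoff i j) - rpsCost d d' σ := by
  simp only [rpsU1, Finset.mul_sum, mul_assoc]

theorem rpsU2_eq (d d' : ℝ) (σ τ : Fin 3 → ℝ) :
    rpsU2 d d' σ τ = ∑ j, τ j * (∑ i, σ i * -rpsPayoff i j) - rpsCost d d' τ := by
  rw [rpsU2, Finset.sum_comm]
  simp only [Finset.mul_sum, mul_neg, Finset.sum_neg_distrib, mul_assoc, mul_left_comm]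

theorem rpsPayoff_add_one_left (j : Fin 3) : rpsPayoff (j + 1) j = 1 := if_pos rfl

theorem rpsPayoff_add_one_right (i : Fin 3) : rpsPayoff i (i + 1) = -1 := by
  fin_cases i <;> simp [rpsPayoff]

/-- The machine-game version of rock-paper-scissors in which randomization is
costly (`d < d'`) has no Nash equilibrium. -/
theorem rps_costly_randomization_no_nash (d d' : ℝ) (hdd' : d < d') :
    ¬ ∃ (σ τ : Fin 3 → ℝ), IsDist σ ∧ IsDist τ ∧
      (∀ σ' : Fin 3 → ℝ, IsDist σ' → rpsU1 d d' σ τ ≥ rpsU1 d d' σ' τ) ∧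
      (∀ τ' : Fin 3 → ℝ, IsDist τ' → rpsU2 d d' σ τ ≥ rpsU2 d d' σ τ') := by
  rintro ⟨σ, τ, hσ, hτ, h₁, h₂⟩
  obtain ⟨s, rfl, hs⟩ := exists_eq_single_of_isMax hdd' hσ (fun i => ∑ j, τ j * rpsPayoff i j)
    fun σ' hσ' => by simpa only [rpsU1_eq] using h₁ σ' hσ'
  obtain ⟨t, rfl, ht⟩ := exists_eq_single_of_isMax hdd' hτ
    (fun j => ∑ i, (Pi.single s 1 : Fin 3 → ℝ) i * -rpsPayoff i j)
    fun τ' hτ' => by simpa only [rpsU2_eq] using h₂ τ' hτ'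
  have hs' := hs (t + 1)
  have ht' := ht (s + 1)
  simp [Pi.single_apply, rpsPayoff_add_one_left, rpsPayoff_add_one_right] at hs' ht'
  linarith
end

section
/- In the costly-information-processing model, an optimal decision maker reads only boundedly many signals: fix ρ with 1/2 < ρ < 1 and c > 0. Let b be uniformly distributed on {0,1} and, conditional on b, let the signals s_1, s_2, … be i.i.d. with P(s_i = b) = ρ. Then there exists an odd m ∈ ℕ such that for every k > m and every function g : {0,1}^k → {0,1}, P(g(s_1,…,s_k) = b) − k·c < P(maj_m(s_1,…,s_m) = b) − m·c, where maj_m denotes the majority value among s_1,…,s_m. In particular, the rule that reads only the first m signals and outputs their majority strictly dominates every rule that reads more than m signals. -/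
open Finset

/-- The probability that a decision rule `g` reading the first `k` signals
guesses the hidden bit correctly: the bit `b` is uniform on `Bool`, and given
`b` the signals are i.i.d., each equal to `b` with probability `ρ`. -/
noncomputable def correctProb (ρ : ℝ) (k : ℕ) (g : (Fin k → Bool) → Bool) : ℝ :=
  ∑ b : Bool, (1 / 2 : ℝ) *
    ∑ s : Fin k → Bool,
      (∏ i : Fin k, if s i = b then ρ else 1 - ρ) * (if g s = b then 1 else 0)

/-- The majority rule on `m` signals: outputs `true` iff more than half of the
signals are `true`. -/
def majorityRule (m : ℕ) (s : Fin m → Bool) : Bool :=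
  m < 2 * (Finset.univ.filter (fun i => s i = true)).card

/-- The likelihoods of the signal vectors given the hidden bit sum to one. -/
theorem sum_signal_likelihood (ρ : ℝ) (k : ℕ) (b : Bool) :
    ∑ s : Fin k → Bool, ∏ i : Fin k, (if s i = b then ρ else 1 - ρ) = 1 := by
  rw [← Fintype.sum_pow (fun a : Bool => if a = b then ρ else 1 - ρ) k]
  cases b <;> simp

theorem signal_likelihood_nonneg {ρ : ℝ} (h0 : 0 ≤ ρ) (h1 : ρ ≤ 1) {k : ℕ} (b : Bool)
    (s : Fin k → Bool) : 0 ≤ ∏ i : Fin k, (if s i = b then ρ else 1 - ρ) :=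
  Finset.prod_nonneg fun i _ => by split_ifs <;> linarith

theorem correctProb_le_one {ρ : ℝ} (h0 : 0 ≤ ρ) (h1 : ρ ≤ 1) (k : ℕ)
    (g : (Fin k → Bool) → Bool) : correctProb ρ k g ≤ 1 := by
  have h (b : Bool) : ∑ s : Fin k → Bool,
      (∏ i : Fin k, if s i = b then ρ else 1 - ρ) * (if g s = b then 1 else 0) ≤ 1 := by
    refine (Finset.sum_le_sum fun s _ => mul_le_of_le_one_right
      (signal_likelihood_nonneg h0 h1 b s) ?_).trans_eq (sum_signal_likelihood ρ k b)
    split_ifs <;> norm_num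
  rw [correctProb, Fintype.sum_bool]
  linarith [h true, h false]

/-- If the majority differs from `b`, at most half of the signals equal `b`. -/
theorem card_eq_le_card_ne_of_majorityRule_ne {m : ℕ} {s : Fin m → Bool} {b : Bool}
    (h : majorityRule m s ≠ b) :
    (Finset.univ.filter fun i => s i = b).card ≤ (Finset.univ.filter fun i => ¬ s i = b).card := by
  have hcard := Finset.card_filter_add_card_filter_not
    (s := (Finset.univ : Finset (Fin m))) (fun i => s i = true)
  rw [Finset.card_univ, Fintype.card_fin] at hcard
  cases b <;> simp [majorityRule] at h hcard ⊢ <;> omega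

/-- Exponential Markov inequality for the event that the majority is wrong. -/
theorem one_sub_prod_le_majorityRule_indicator {t : ℝ} (ht : 1 ≤ t) {m : ℕ}
    (s : Fin m → Bool) (b : Bool) :
    1 - ∏ i : Fin m, (if s i = b then t⁻¹ else t) ≤ if majorityRule m s = b then 1 else 0 := by
  have ht0 : 0 < t := by linarith
  split_ifs with h
  · have : 0 ≤ ∏ i : Fin m, (if s i = b then t⁻¹ else t) :=
      Finset.prod_nonneg fun i _ => by split_ifs <;> positivity
    linarith
  · rw [Finset.prod_ite, Finset.prod_const, Finset.prod_const, inv_pow, sub_nonpos,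
      inv_mul_eq_div, one_le_div (by positivity)]
    exact pow_le_pow_right₀ ht (card_eq_le_card_ne_of_majorityRule_ne h)

/-- Chernoff bound for the majority rule. -/
theorem one_sub_pow_le_correctProb_majorityRule {ρ t : ℝ} (h0 : 0 ≤ ρ) (h1 : ρ ≤ 1)
    (ht : 1 ≤ t) (m : ℕ) :
    1 - (ρ * t⁻¹ + (1 - ρ) * t) ^ m ≤ correctProb ρ m (majorityRule m) := by
  have h (b : Bool) : 1 - (ρ * t⁻¹ + (1 - ρ) * t) ^ m ≤ ∑ s : Fin m → Bool,
      (∏ i : Fin m, if s i = b then ρ else 1 - ρ) * (if majorityRule m s = b then 1 else 0) := by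
    have hsum : ρ * t⁻¹ + (1 - ρ) * t =
        ∑ a : Bool, (if a = b then ρ else 1 - ρ) * (if a = b then t⁻¹ else t) := by
      cases b <;> simp [add_comm]
    have hone := sum_signal_likelihood ρ m b
    rw [hsum, Fintype.sum_pow]
    refine (congrArg (· - _) hone.symm).trans_le ?_
    rw [← Finset.sum_sub_distrib]
    refine Finset.sum_le_sum fun s _ => ?_
    rw [Finset.prod_mul_distrib, ← mul_one_sub]
    exact mul_le_mul_of_nonneg_left (one_sub_prod_le_majorityRule_indicator ht s b)
      (signal_likelihood_nonneg h0 h1 b s)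
  rw [correctProb, Fintype.sum_bool]
  linarith [h true, h false]

/-- With signal quality `1/2 < ρ < 1` and per-signal reading cost `c > 0`,
there is an odd `m` such that reading the first `m` signals and outputting
their majority strictly dominates every decision rule that reads more than `m`
signals. -/
theorem costly_information_bounded_reading (ρ c : ℝ)
    (hρ : 1 / 2 < ρ) (hρ1 : ρ < 1) (hc : 0 < c) :
    ∃ m : ℕ, Odd m ∧ ∀ k > m, ∀ g : (Fin k → Bool) → Bool,
      correctProb ρ k g - k * c < correctProb ρ m (majorityRule m) - m * c := by
  have h0 : 0 ≤ ρ := by linarith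
  set r : ℝ := ρ * (2 * ρ)⁻¹ + (1 - ρ) * (2 * ρ) with hr
  have hr' : r = 1 / 2 + 2 * ρ * (1 - ρ) := by
    rw [hr]
    field_simp
  have hr0 : 0 ≤ r := by nlinarith
  have hr1 : r < 1 := by nlinarith
  obtain ⟨n, hn⟩ := exists_pow_lt_of_lt_one hc hr1
  refine ⟨2 * n + 1, ⟨n, rfl⟩, fun k hk g => ?_⟩
  have hpow : r ^ (2 * n + 1) ≤ r ^ n := pow_le_pow_of_le_one hr0 hr1.le (by omega)
  have hmaj := one_sub_pow_le_correctProb_majorityRule (t := 2 * ρ) h0 hρ1.le (by linarith)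
    (2 * n + 1)
  rw [← hr] at hmaj
  have hle := correctProb_le_one h0 hρ1.le k g
  have hcost : ((2 * n + 1 : ℕ) + 1 : ℝ) * c ≤ k * c :=
    mul_le_mul_of_nonneg_right (by exact_mod_cast hk) hc.le
  linarith
end
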